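/- arXiv:2104.08533 — 4 statements merged into one kernel-verified Lean document; each statement's English description precedes it below -/
import Mathlib

section
/- Let h ∈ ℋ₁, let 0 ≤ b ≤ 1 and −1 ≤ m ≤ 1 with b + e^{imπ} ≠ 0. If h(z) ≺ (1 + e^{imπ}z)/(1 − bz), then Re( e^{−iλ} h(z) ) > 0 for all z ∈ 𝔻, where λ = arctan( b·sin(mπ) / (b·cos(mπ) + 1) ). -/
open Complex

/-- The open unit disk in the complex plane. -/
noncomputable def unitDisk : Set ℂ := Metric.ball 0 1

/-- `Subord f g` : `f` is subordinate to `g` on the unit disk, i.e. there is an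
analytic self-map `ω` of the disk fixing `0` with `f = g ∘ ω`. -/
def Subord (f g : ℂ → ℂ) : Prop :=
  ∃ ω : ℂ → ℂ, AnalyticOnNhd ℂ ω unitDisk ∧ ω 0 = 0 ∧
    (∀ z ∈ unitDisk, ω z ∈ unitDisk) ∧ ∀ z ∈ unitDisk, f z = g (ω z)

/-- The polynomial inequality behind the half-plane containment: here `c ^ 2 + s ^ 2 = 1`, and the
left-over expression is the real part of `(1 + b * conj e) * (1 + e * w) * conj (1 - b * w)` for
`e = c + s * I` and `w = x + y * I`. -/
theorem halfPlane_numerator_pos {b c s x y : ℝ} (hb0 : 0 ≤ b) (hb1 : b ≤ 1)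
    (hcs : c ^ 2 + s ^ 2 = 1) (hD : 0 < 1 + b * c) (hE : 0 < 1 + b ^ 2 + 2 * b * c)
    (hw : x ^ 2 + y ^ 2 < 1) :
    0 < 1 + b * c - (b * c + b ^ 2) * (x ^ 2 + y ^ 2) + (1 - b ^ 2) * (c * x - s * y) := by
  obtain ⟨r, hr0, hr⟩ : ∃ r : ℝ, 0 ≤ r ∧ r ^ 2 = x ^ 2 + y ^ 2 :=
    ⟨√(x ^ 2 + y ^ 2), Real.sqrt_nonneg _, Real.sq_sqrt (by positivity)⟩
  have hr1 : r < 1 := by nlinarith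
  have hcauchy : -r ≤ c * x - s * y := by
    refine neg_le_of_abs_le (abs_le_of_sq_le_sq ?_ hr0)
    linear_combination sq_nonneg (s * x + c * y) + (x ^ 2 + y ^ 2) * hcs - hr
  have hfactor : 0 < (1 - r) * ((1 - r) * (1 + b * c) + r * (1 + b ^ 2 + 2 * b * c)) := by
    refine mul_pos (by linarith) ?_
    have := mul_pos (sub_pos.2 hr1) hD
    have := mul_nonneg hr0 hE.le
    linarith
  have := mul_le_mul_of_nonneg_left hcauchy (show 0 ≤ 1 - b ^ 2 by nlinarith)
  rw [← hr]
  linarith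

theorem stmt_5 (b m : ℝ) (hb0 : 0 ≤ b) (hb1 : b ≤ 1) (hm : -1 ≤ m) (hm1 : m ≤ 1)
    (hne : (b : ℂ) + Complex.exp ((m * Real.pi : ℝ) * Complex.I) ≠ 0)
    (h : ℂ → ℂ) (hh : AnalyticOnNhd ℂ h unitDisk) (h0 : h 0 = 1)
    (hsub : Subord h (fun z =>
      (1 + Complex.exp ((m * Real.pi : ℝ) * Complex.I) * z) / (1 - (b : ℂ) * z))) :
    ∀ z ∈ unitDisk,
      0 < (Complex.exp (-((Real.arctan (b * Real.sin (m * Real.pi) /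
            (b * Real.cos (m * Real.pi) + 1)) : ℝ) * Complex.I)) * h z).re := by
  intro z hz
  obtain ⟨ω, -, -, hω, hhω⟩ := hsub
  have hw := hω z hz
  rw [hhω z hz]
  generalize ω z = w at hw
  set θ := m * Real.pi
  have he : Complex.exp ((θ : ℝ) * Complex.I) = ⟨Real.cos θ, Real.sin θ⟩ := by
    apply Complex.ext <;> simp [Complex.exp_ofReal_mul_I_re, Complex.exp_ofReal_mul_I_im]
  rw [he] at hne ⊢
  have hcs : Real.cos θ ^ 2 + Real.sin θ ^ 2 = 1 := Real.cos_sq_add_sin_sq θ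
  generalize Real.cos θ = c at *
  generalize Real.sin θ = s at *
  have hE : 0 < 1 + b ^ 2 + 2 * b * c := by
    have := Complex.normSq_pos.2 hne
    simp only [Complex.normSq_apply, Complex.add_re, Complex.add_im, Complex.ofReal_re,
      Complex.ofReal_im] at this
    linear_combination this + hcs
  have hD : 0 < b * c + 1 := by nlinarith
  have hw1 : w.re ^ 2 + w.im ^ 2 < 1 := by
    have : ‖w‖ < 1 := by simpa [unitDisk] using hw
    have h2 := Complex.sq_norm w
    rw [Complex.normSq_apply] at h2
    nlinarith [norm_nonneg w]
  have hN := halfPlane_numerator_pos hb0 hb1 hcs (by linarith) hE hw1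
  have hden : 0 < Complex.normSq (1 - (b : ℂ) * w) := by
    refine Complex.normSq_pos.2 fun h1 => ?_
    have hre := congrArg Complex.re h1
    simp only [Complex.sub_re, Complex.one_re, Complex.re_ofReal_mul, Complex.zero_re] at hre
    have hb2 : b ^ 2 * w.re ^ 2 ≤ 1 * w.re ^ 2 := by gcongr; exact pow_le_one₀ hb0 hb1
    nlinarith [sq_nonneg w.im]
  set t := b * s / (b * c + 1) with ht
  have hexp : Complex.exp (-((Real.arctan t : ℝ) * Complex.I)) =
      ⟨Real.cos (Real.arctan t), -(Real.cos (Real.arctan t) * t)⟩ := by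
    rw [← neg_mul, ← Complex.ofReal_neg]
    apply Complex.ext
    · rw [Complex.exp_ofReal_mul_I_re, Real.cos_neg]
    · rw [Complex.exp_ofReal_mul_I_im, Real.sin_neg, Real.sin_arctan, Real.cos_arctan]
      ring
  rw [hexp]
  have key : 0 < Real.cos (Real.arctan t) / (b * c + 1) / Complex.normSq (1 - (b : ℂ) * w) *
      (1 + b * c - (b * c + b ^ 2) * (w.re ^ 2 + w.im ^ 2) +
        (1 - b ^ 2) * (c * w.re - s * w.im)) :=
    mul_pos (div_pos (div_pos (Real.cos_arctan_pos t) hD) hden) hN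
  convert key using 1
  simp only [Complex.mul_re, Complex.div_re, Complex.div_im, Complex.add_re, Complex.add_im,
    Complex.mul_im, Complex.sub_re, Complex.sub_im, Complex.one_re, Complex.one_im,
    Complex.ofReal_re, Complex.ofReal_im]
  generalize Complex.normSq (1 - (b : ℂ) * w) = q at *
  rw [ht]
  field_simp
  linear_combination (b * w.re - b ^ 2 * (w.re ^ 2 + w.im ^ 2)) * hcs
end

section
/- Let α ∈ (0, 1], l, m ∈ [−1, 1] and a, b, c, d ∈ [0, 1] with a·e^{ilπ} + b ≠ 0 and c·e^{imπ} + d ≠ 0. Let Q be analytic on 𝔻 with Q(0) = 1 satisfying Q(z) ≺ (1 + a e^{ilπ} z)/(1 − b z), and let p ∈ ℋ₁ satisfy Q(z)·(p(z))^α ≺ (1 + c e^{imπ} z)/(1 − d z). Suppose μ := arcsin√( (c² + d² + 2cd·cos(mπ)) / (1 + c²d² + 2cd·cos(mπ)) ) + arcsin√( (a² + b² + 2ab·cos(lπ)) / (1 + a²b² + 2ab·cos(lπ)) ) ≤ απ/2. Then Re( e^{−iγπ/2} p(z) ) > 0 for all z ∈ 𝔻, where γ = (arctan A − arctan B)/μ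 with A = c d·sin(mπ)/(c d·cos(mπ) + 1) and B = a b·sin(lπ)/(a b·cos(lπ) + 1). -/
open Complex

/-- The Möbius image `v` of a point of the disk lies in an open cone around `1 + d e`. -/
theorem mobius_re_gt {e v w : ℂ} {d : ℝ} (hd0 : 0 ≤ d) (hd1 : d ≤ 1) (he : ‖e‖ ≤ 1)
    (hne : e + d ≠ 0) (hw : ‖w‖ < 1) (hv : v * (1 - d * w) = 1 + e * w) :
    √((1 - ‖e‖ ^ 2) * (1 - d ^ 2)) * ‖v‖ < (v * (starRingEnd ℂ) (1 + d * e)).re := by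
  have h1 : v - 1 = w * (e + d * v) := by linear_combination hv
  have h2 : e + d * v ≠ 0 := by
    intro h
    rw [h, mul_zero, sub_eq_zero] at h1
    rw [h1, mul_one] at h
    exact hne h
  have h3 : ‖v - 1‖ < ‖e + d * v‖ := by
    rw [h1, norm_mul]
    exact mul_lt_of_lt_one_left (norm_pos_iff.2 h2) hw
  have h4 : ‖v - 1‖ ^ 2 < ‖e + d * v‖ ^ 2 := by gcongr
  have h5 : (1 - d ^ 2) * ‖v‖ ^ 2 + (1 - ‖e‖ ^ 2) < 2 * (v * (starRingEnd ℂ) (1 + d * e)).re := by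
    simp only [← Complex.normSq_eq_norm_sq, Complex.normSq_apply] at h4 ⊢
    simp at h4 ⊢
    nlinarith
  have hE : 0 ≤ 1 - ‖e‖ ^ 2 := by nlinarith [norm_nonneg e]
  have hD : 0 ≤ 1 - d ^ 2 := by nlinarith
  rw [Real.sqrt_mul hE]
  nlinarith [sq_nonneg (√(1 - ‖e‖ ^ 2) - √(1 - d ^ 2) * ‖v‖), Real.sq_sqrt hE, Real.sq_sqrt hD]

theorem one_add_mul_re_pos {e : ℂ} {d : ℝ} (hd0 : 0 ≤ d) (hd1 : d ≤ 1) (he : ‖e‖ ≤ 1)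
    (hne : e + d ≠ 0) : 0 < (1 + d * e).re := by
  have hre := (abs_le.1 (Complex.abs_re_le_norm e)).1
  have hsq : e.re * e.re + e.im * e.im ≤ 1 := by
    rw [← Complex.normSq_apply, Complex.normSq_eq_norm_sq]
    nlinarith [norm_nonneg e]
  have hform : (1 + (d : ℂ) * e).re = 1 + d * e.re := by simp
  rw [hform]
  by_contra! h
  have h2 : d = 1 := by nlinarith [mul_nonneg hd0 (by linarith : (0 : ℝ) ≤ e.re + 1)]
  have h1 : e.re = -1 := by rw [h2] at h; linarith
  have h3 : e.im = 0 := by nlinarith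
  exact hne (Complex.ext (by simp [h1, h2]) (by simp [h3]))

/-- Polar form of `mobius_re_gt`: the half-opening of the cone is
`arcsin (‖e + d‖ / ‖1 + d e‖)`, and its axis has argument `arctan`. -/
theorem mobius_cos_lt {e v w : ℂ} {d : ℝ} (hd0 : 0 ≤ d) (hd1 : d ≤ 1) (he : ‖e‖ ≤ 1)
    (hne : e + d ≠ 0) (hw : ‖w‖ < 1) (hv : v * (1 - d * w) = 1 + e * w) :
    Real.cos (Real.arcsin √(‖e + d‖ ^ 2 / ‖1 + d * e‖ ^ 2)) * ‖v‖ <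
      (v * Complex.exp (-(Real.arctan ((1 + d * e).im / (1 + d * e).re) * Complex.I))).re := by
  have hpos := one_add_mul_re_pos hd0 hd1 he hne
  have key := mobius_re_gt hd0 hd1 he hne hw hv
  have hX : ‖1 + d * e‖ ^ 2 - ‖e + d‖ ^ 2 = (1 - ‖e‖ ^ 2) * (1 - d ^ 2) := by
    simp only [← Complex.normSq_eq_norm_sq, Complex.normSq_apply]
    simp
    ring
  set C : ℂ := 1 + d * e with hC
  have hn : 0 < ‖C‖ := norm_pos_iff.2 fun h => by simp [h] at hpos
  have harg : Real.arctan (C.im / C.re) = C.arg := by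
    rw [← Complex.tan_arg, Real.arctan_tan]
    · exact (abs_lt.1 (Complex.abs_arg_lt_pi_div_two_iff.2 (Or.inl hpos))).1
    · exact (abs_lt.1 (Complex.abs_arg_lt_pi_div_two_iff.2 (Or.inl hpos))).2
  have hcos : Real.cos (Real.arcsin √(‖e + d‖ ^ 2 / ‖C‖ ^ 2)) * ‖C‖ =
      √((1 - ‖e‖ ^ 2) * (1 - d ^ 2)) := by
    rw [Real.cos_arcsin, Real.sq_sqrt (by positivity), ← hX]
    nth_rewrite 2 [← Real.sqrt_sq hn.le]
    rw [← Real.sqrt_mul' _ (by positivity)]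
    congr 1
    field_simp
  have hconj : (starRingEnd ℂ) C = ‖C‖ * Complex.exp (-(C.arg * Complex.I)) := by
    conv_lhs => rw [← Complex.norm_mul_exp_arg_mul_I C]
    rw [map_mul, Complex.conj_ofReal, ← Complex.exp_conj]
    simp
  rw [harg]
  rw [← hcos, hconj, mul_left_comm, Complex.re_ofReal_mul] at key
  nlinarith

theorem abs_lt_of_cos_lt {φ τ : ℝ} (hφ0 : 0 ≤ φ) (hτ : |τ| ≤ Real.pi)
    (h : Real.cos φ < Real.cos τ) : |τ| < φ := by
  by_contra! hle
  have := Real.cos_le_cos_of_nonneg_of_le_pi hφ0 hτ hle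
  rw [Real.cos_abs] at this
  linarith

theorem exists_arg_near {v : ℂ} {φ τ : ℝ} (hφ0 : 0 ≤ φ)
    (h : Real.cos φ * ‖v‖ < (v * Complex.exp (-(τ * Complex.I))).re) :
    ∃ θ : ℝ, v = ‖v‖ * Complex.exp (θ * Complex.I) ∧ |θ - τ| < φ := by
  set u := v * Complex.exp (-(τ * Complex.I)) with hu
  have hv : v = u * Complex.exp (τ * Complex.I) := by
    rw [hu, mul_assoc, ← Complex.exp_add, neg_add_cancel, Complex.exp_zero, mul_one]
  have hnorm : ‖v‖ = ‖u‖ := by rw [hv, norm_mul, Complex.norm_exp_ofReal_mul_I, mul_one]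
  refine ⟨τ + u.arg, ?_, ?_⟩
  · rw [hnorm]
    push_cast
    rw [add_mul, add_comm, Complex.exp_add, ← mul_assoc, Complex.norm_mul_exp_arg_mul_I]
    exact hv
  · rw [add_sub_cancel_left]
    rw [hnorm, ← Complex.norm_mul_cos_arg u, mul_comm] at h
    have hlt := lt_of_mul_lt_mul_left h (norm_nonneg u)
    exact abs_lt_of_cos_lt hφ0 (Complex.abs_arg_le_pi u) hlt

/-- A function subordinate to a Möbius map takes values in the cone spanned by the image. -/
theorem subord_mobius_arg {f : ℂ → ℂ} {a b l : ℝ} (ha0 : 0 ≤ a) (ha1 : a ≤ 1) (hb0 : 0 ≤ b)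
    (hb1 : b ≤ 1)
    (hab : (a : ℂ) * Complex.exp ((l * Real.pi : ℝ) * Complex.I) + (b : ℂ) ≠ 0)
    (hf : Subord f (fun z =>
      (1 + (a : ℂ) * Complex.exp ((l * Real.pi : ℝ) * Complex.I) * z) / (1 - (b : ℂ) * z)))
    {φ τ : ℝ}
    (hφ : φ = Real.arcsin (√((a ^ 2 + b ^ 2 + 2 * a * b * Real.cos (l * Real.pi)) /
        (1 + a ^ 2 * b ^ 2 + 2 * a * b * Real.cos (l * Real.pi)))))
    (hτ : τ = Real.arctan (a * b * Real.sin (l * Real.pi) / (a * b * Real.cos (l * Real.pi) + 1))) :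
    |τ| < φ ∧ ∀ z ∈ unitDisk, f z ≠ 0 ∧
      ∃ θ : ℝ, f z = ‖f z‖ * Complex.exp (θ * Complex.I) ∧ |θ - τ| < φ := by
  set e : ℂ := (a : ℂ) * Complex.exp ((l * Real.pi : ℝ) * Complex.I) with he
  have hre : e.re = a * Real.cos (l * Real.pi) := by
    rw [he, Complex.re_ofReal_mul, Complex.exp_ofReal_mul_I_re]
  have him : e.im = a * Real.sin (l * Real.pi) := by
    rw [he, Complex.im_ofReal_mul, Complex.exp_ofReal_mul_I_im]
  have hen : ‖e‖ = a := by
    rw [he, norm_mul, Complex.norm_exp_ofReal_mul_I, mul_one, Complex.norm_of_nonneg ha0]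
  have hsc := Real.sin_sq_add_cos_sq (l * Real.pi)
  have hφ' : φ = Real.arcsin √(‖e + b‖ ^ 2 / ‖1 + b * e‖ ^ 2) := by
    rw [hφ]
    simp only [← Complex.normSq_eq_norm_sq, Complex.normSq_apply]
    simp only [Complex.add_re, Complex.add_im, Complex.ofReal_re, Complex.ofReal_im,
      Complex.re_ofReal_mul, Complex.im_ofReal_mul, Complex.one_re, Complex.one_im, hre, him]
    congr 3
    · linear_combination -a ^ 2 * hsc
    · linear_combination -a ^ 2 * b ^ 2 * hsc
  have hτ' : τ = Real.arctan ((1 + b * e).im / (1 + b * e).re) := by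
    rw [hτ]
    simp only [Complex.add_re, Complex.add_im,
      Complex.re_ofReal_mul, Complex.im_ofReal_mul, Complex.one_re, Complex.one_im, hre, him]
    congr 2 <;> ring
  have hφ0 : 0 ≤ φ := by rw [hφ']; exact Real.arcsin_nonneg.2 (Real.sqrt_nonneg _)
  have cone : ∀ v w : ℂ, ‖w‖ < 1 → v * (1 - b * w) = 1 + e * w →
      Real.cos φ * ‖v‖ < (v * Complex.exp (-(τ * Complex.I))).re := by
    intro v w hw hv
    rw [hφ', hτ']
    exact mobius_cos_lt hb0 hb1 (hen.trans_le ha1) hab hw hv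
  have hnz : ∀ (r : ℂ) (w : ℂ), ‖r‖ ≤ 1 → ‖w‖ < 1 → 1 + r * w ≠ 0 := by
    intro r w hr hw h
    have h1 : ‖r * w‖ = 1 := by
      rw [eq_neg_of_add_eq_zero_right h, norm_neg, norm_one]
    rw [norm_mul] at h1
    nlinarith [norm_nonneg r, norm_nonneg w]
  constructor
  · apply abs_lt_of_cos_lt hφ0
    · rw [hτ, abs_le]
      constructor <;> linarith [Real.arctan_lt_pi_div_two
        (a * b * Real.sin (l * Real.pi) / (a * b * Real.cos (l * Real.pi) + 1)),
        Real.neg_pi_div_two_lt_arctan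
        (a * b * Real.sin (l * Real.pi) / (a * b * Real.cos (l * Real.pi) + 1)), Real.pi_pos]
    · have := cone 1 0 (by simp) (by simp)
      rw [norm_one, mul_one, one_mul, ← neg_mul, ← Complex.ofReal_neg,
        Complex.exp_ofReal_mul_I_re, Real.cos_neg] at this
      exact this
  · intro z hz
    obtain ⟨ω, -, -, hω, hfω⟩ := hf
    have hw : ‖ω z‖ < 1 := by simpa [unitDisk] using hω z hz
    have hden : 1 - (b : ℂ) * ω z ≠ 0 := by
      have := hnz (-b) (ω z) (by rw [norm_neg, Complex.norm_of_nonneg hb0]; exact hb1) hw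
      rwa [neg_mul, ← sub_eq_add_neg] at this
    have hnum : 1 + e * ω z ≠ 0 := hnz e _ (hen.trans_le ha1) hw
    have hv : f z = (1 + e * ω z) / (1 - b * ω z) := hfω z hz
    refine ⟨?_, exists_arg_near hφ0 (cone _ (ω z) hw ?_)⟩
    · rw [hv]; exact div_ne_zero hnum hden
    · rw [hv, div_mul_cancel₀ _ hden]

/-- If `q * x ^ α` and `q` have arguments `θ₂` and `θ₁` with `θ₂ - θ₁` small enough, then
`α * arg x = θ₂ - θ₁`. -/
theorem mul_arg_eq_of_mul_cpow {α θ₁ θ₂ : ℝ} {q x : ℂ} (hα0 : 0 < α) (hα1 : α ≤ 1) (hx : x ≠ 0)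
    (hq : q ≠ 0) (h₁ : q = ‖q‖ * Complex.exp (θ₁ * Complex.I))
    (h₂ : q * x ^ (α : ℂ) = ‖q * x ^ (α : ℂ)‖ * Complex.exp (θ₂ * Complex.I))
    (hlt : |θ₂ - θ₁| < α * Real.pi) : α * x.arg = θ₂ - θ₁ := by
  have hxn : 0 < ‖x‖ := norm_pos_iff.2 hx
  have hqn : 0 < ‖q‖ := norm_pos_iff.2 hq
  have hpow : x ^ (α : ℂ) = (‖x‖ ^ α : ℝ) * Complex.exp ((α * x.arg : ℝ) * Complex.I) := by
    rw [Complex.cpow_def_of_ne_zero hx, Complex.log, Real.rpow_def_of_pos hxn, Complex.ofReal_exp,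
      ← Complex.exp_add]
    congr 1
    push_cast
    ring
  have hpn : ‖x ^ (α : ℂ)‖ = ‖x‖ ^ α := by
    rw [hpow, norm_mul, Complex.norm_exp_ofReal_mul_I, mul_one,
      Complex.norm_of_nonneg (by positivity)]
  have hr : ((‖q‖ * ‖x‖ ^ α : ℝ) : ℂ) ≠ 0 := by
    rw [Complex.ofReal_ne_zero]; positivity
  have hexp : Complex.exp ((θ₁ + α * x.arg : ℝ) * Complex.I) = Complex.exp (θ₂ * Complex.I) := by
    apply mul_left_cancel₀ hr
    rw [norm_mul, hpn] at h₂
    rw [← h₂]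
    conv_rhs => rw [h₁, hpow]
    push_cast
    rw [add_mul, Complex.exp_add]
    ring
  obtain ⟨n, hn⟩ := Complex.exp_eq_exp_iff_exists_int.1 hexp
  have hn' : θ₁ + α * x.arg = θ₂ + n * (2 * Real.pi) := by
    have := congrArg Complex.im hn
    simpa using this
  have hπ := Real.pi_pos
  obtain ⟨hl, hu⟩ := abs_lt.1 hlt
  have hn1 : (n : ℝ) < 1 := by
    nlinarith [Complex.arg_le_pi x]
  have hn2 : (-1 : ℝ) < n := by
    nlinarith [Complex.neg_pi_lt_arg x]
  have hn0 : n = 0 := by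
    have h1 : n < 1 := by exact_mod_cast hn1
    have h2 : -1 < n := by exact_mod_cast hn2
    omega
  rw [hn0] at hn'
  push_cast at hn'
  linarith

theorem stmt_16 (α l m a b c d : ℝ) (hα0 : 0 < α) (hα1 : α ≤ 1)
    (hl : -1 ≤ l) (hl1 : l ≤ 1) (hm : -1 ≤ m) (hm1 : m ≤ 1)
    (ha0 : 0 ≤ a) (ha1 : a ≤ 1) (hb0 : 0 ≤ b) (hb1 : b ≤ 1)
    (hc0 : 0 ≤ c) (hc1 : c ≤ 1) (hd0 : 0 ≤ d) (hd1 : d ≤ 1)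
    (hab : (a : ℂ) * Complex.exp ((l * Real.pi : ℝ) * Complex.I) + (b : ℂ) ≠ 0)
    (hcd : (c : ℂ) * Complex.exp ((m * Real.pi : ℝ) * Complex.I) + (d : ℂ) ≠ 0)
    (Q : ℂ → ℂ) (hQ : AnalyticOnNhd ℂ Q unitDisk) (hQ0 : Q 0 = 1)
    (hQsub : Subord Q (fun z =>
      (1 + (a : ℂ) * Complex.exp ((l * Real.pi : ℝ) * Complex.I) * z) / (1 - (b : ℂ) * z)))
    (p : ℂ → ℂ) (hp : AnalyticOnNhd ℂ p unitDisk) (hp0 : p 0 = 1)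
    (hQp : Subord (fun z => Q z * (p z) ^ (α : ℂ)) (fun z =>
      (1 + (c : ℂ) * Complex.exp ((m * Real.pi : ℝ) * Complex.I) * z) / (1 - (d : ℂ) * z)))
    (μ : ℝ)
    (hμ : μ = Real.arcsin (Real.sqrt ((c ^ 2 + d ^ 2 + 2 * c * d * Real.cos (m * Real.pi)) /
        (1 + c ^ 2 * d ^ 2 + 2 * c * d * Real.cos (m * Real.pi)))) +
      Real.arcsin (Real.sqrt ((a ^ 2 + b ^ 2 + 2 * a * b * Real.cos (l * Real.pi)) /
        (1 + a ^ 2 * b ^ 2 + 2 * a * b * Real.cos (l * Real.pi)))))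
    (hμα : μ ≤ α * Real.pi / 2)
    (γ : ℝ)
    (hγ : γ = (Real.arctan (c * d * Real.sin (m * Real.pi) / (c * d * Real.cos (m * Real.pi) + 1)) -
      Real.arctan (a * b * Real.sin (l * Real.pi) / (a * b * Real.cos (l * Real.pi) + 1))) / μ) :
    ∀ z ∈ unitDisk,
      0 < (Complex.exp (-((γ * Real.pi / 2 : ℝ) * Complex.I)) * p z).re := by
  intro z hz
  obtain ⟨hA, hcone₂⟩ := subord_mobius_arg hc0 hc1 hd0 hd1 hcd hQp rfl rfl
  obtain ⟨hB, hcone₁⟩ := subord_mobius_arg ha0 ha1 hb0 hb1 hab hQsub rfl rfl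
  obtain ⟨hq, θ₁, hθ₁, hd₁⟩ := hcone₁ z hz
  obtain ⟨hqp, θ₂, hθ₂, hd₂⟩ := hcone₂ z hz
  have hx : p z ≠ 0 := by
    intro h
    rw [h, Complex.zero_cpow (Complex.ofReal_ne_zero.2 hα0.ne'), mul_zero] at hqp
    exact hqp rfl
  rw [abs_lt] at hA hB hd₁ hd₂
  have hμ0 : 0 < μ := by linarith
  have hγμ : γ * μ = _ := (eq_div_iff hμ0.ne').1 hγ
  have harg : α * (p z).arg = θ₂ - θ₁ := by
    refine mul_arg_eq_of_mul_cpow hα0 hα1 hx hq hθ₁ hθ₂ ?_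
    rw [abs_lt]
    constructor <;> linarith
  have hγ1 : γ < 1 := by nlinarith
  have hγ2 : -1 < γ := by nlinarith
  have hu : α * (p z).arg < μ * (γ + 1) := by linarith
  have hl' : μ * (γ - 1) < α * (p z).arg := by linarith
  have hu' : (p z).arg - γ * Real.pi / 2 < Real.pi / 2 := by nlinarith
  have hl'' : -(Real.pi / 2) < (p z).arg - γ * Real.pi / 2 := by nlinarith
  have hcos := Real.cos_pos_of_mem_Ioo ⟨hl'', hu'⟩
  have hform : Complex.exp (-((γ * Real.pi / 2 : ℝ) * Complex.I)) * p z =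
      ‖p z‖ * Complex.exp (((p z).arg - γ * Real.pi / 2 : ℝ) * Complex.I) := by
    conv_lhs => rw [← Complex.norm_mul_exp_arg_mul_I (p z)]
    rw [mul_left_comm, ← Complex.exp_add]
    congr 2
    push_cast
    ring
  rw [hform, Complex.re_ofReal_mul, Complex.exp_ofReal_mul_I_re]
  exact mul_pos (norm_pos_iff.2 hx) hcos
end

section
/- Let p ∈ ℋ₁ with p(z) ≠ 0 on 𝔻, let 0 ≤ b ≤ 1 and −1 ≤ m ≤ 1 with b + e^{imπ} ≠ 0, and let 0 < λ ≤ 1 and 0 < γ ≤ 1. If (1−λ)·p(z) + λ·z p'(z) ≺ ((1 + e^{imπ}z)/(1 − bz))^γ · ( 1 − λ + λγ·(b + e^{imπ})z / ((1 + e^{imπ}z)(1 − bz)) ), then Re( e^{−iβ}·(p(z))^{1/γ} ) > 0 for all z ∈ 𝔻, where β = arctan( b·sin(mπ) / (b·cos(mπ) + 1) ). -/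
open Complex

/-- The sine is superhomogeneous for scaling factors in `[0, 1]`. -/
theorem mul_sin_le_sin_mul {t θ : ℝ} (ht0 : 0 ≤ t) (ht1 : t ≤ 1) (hθ0 : 0 ≤ θ)
    (hθ : θ ≤ Real.pi) : t * Real.sin θ ≤ Real.sin (t * θ) := by
  have h := strictConcaveOn_sin_Icc.concaveOn.2 (x := θ) (y := 0) ⟨hθ0, hθ⟩
    ⟨le_rfl, Real.pi_pos.le⟩ ht0 (sub_nonneg.2 ht1) (by ring)
  simpa using h

/-- Weighted arithmetic-geometric mean inequality for real exponentials. -/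
theorem exp_add_le_add_exp {s t x y : ℝ} (hs : 0 ≤ s) (ht : 0 ≤ t) (hst : s + t = 1) :
    Real.exp (s * x + t * y) ≤ s * Real.exp x + t * Real.exp y := by
  simpa using convexOn_exp.2 (Set.mem_univ x) (Set.mem_univ y) hs ht hst

theorem sin_le_exp_mul_sin_add {γ θ : ℝ} (x : ℝ) (hγ0 : 0 ≤ γ) (hγ1 : γ ≤ 1) (hθ0 : 0 ≤ θ)
    (hθ : θ ≤ Real.pi) :
    Real.sin θ ≤ Real.exp ((γ - 1) * x) * Real.sin (γ * θ)
      + Real.exp (γ * x) * Real.sin ((1 - γ) * θ) := by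
  have h1 := mul_sin_le_sin_mul hγ0 hγ1 hθ0 hθ
  have h2 := mul_sin_le_sin_mul (t := 1 - γ) (by linarith) (by linarith) hθ0 hθ
  have h3 := exp_add_le_add_exp (x := (γ - 1) * x) (y := γ * x) hγ0 (sub_nonneg.2 hγ1) (by ring)
  have h0 : γ * ((γ - 1) * x) + (1 - γ) * (γ * x) = 0 := by ring
  rw [h0, Real.exp_zero] at h3
  have hs := Real.sin_nonneg_of_nonneg_of_le_pi hθ0 hθ
  have h4 := mul_le_mul_of_nonneg_left h1 (Real.exp_pos ((γ - 1) * x)).le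
  have h5 := mul_le_mul_of_nonneg_left h2 (Real.exp_pos (γ * x)).le
  have h6 := mul_le_mul_of_nonneg_right h3 hs
  linarith

theorem exp_mul_sin_le_sin_add {γ θ : ℝ} (x : ℝ) (hγ0 : 0 ≤ γ) (hγ1 : γ ≤ 1) (hθ0 : 0 ≤ θ)
    (hθ : θ ≤ Real.pi) :
    Real.exp (γ * x) * Real.sin ((1 + γ) * θ)
      ≤ Real.sin θ + Real.exp ((1 + γ) * x) * Real.sin (γ * θ) := by
  have hpos : 0 < 1 + γ := by linarith
  have hs : 0 ≤ Real.sin θ := Real.sin_nonneg_of_nonneg_of_le_pi hθ0 hθ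
  have hs' : 0 ≤ Real.sin (γ * θ) :=
    Real.sin_nonneg_of_nonneg_of_le_pi (by positivity) (by nlinarith)
  rcases le_total ((1 + γ) * θ) Real.pi with hle | hle
  · have h0 : 0 ≤ (1 + γ) * θ := by positivity
    have h1 := mul_sin_le_sin_mul (t := 1 / (1 + γ)) (by positivity)
      ((div_le_one hpos).2 (by linarith)) h0 hle
    have h2 := mul_sin_le_sin_mul (t := γ / (1 + γ)) (by positivity)
      ((div_le_one hpos).2 (by linarith)) h0 hle
    rw [show 1 / (1 + γ) * ((1 + γ) * θ) = θ by field_simp] at h1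
    rw [show γ / (1 + γ) * ((1 + γ) * θ) = γ * θ by field_simp] at h2
    have h3 := exp_add_le_add_exp (s := 1 / (1 + γ)) (t := γ / (1 + γ)) (x := 0)
      (y := (1 + γ) * x) (by positivity) (by positivity) (by field_simp)
    rw [show 1 / (1 + γ) * 0 + γ / (1 + γ) * ((1 + γ) * x) = γ * x by field_simp; ring,
      Real.exp_zero] at h3
    have h4 := mul_le_mul_of_nonneg_left h2 (Real.exp_pos ((1 + γ) * x)).le
    have h5 := mul_le_mul_of_nonneg_right h3 (Real.sin_nonneg_of_nonneg_of_le_pi h0 hle)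
    linarith
  · have h1 : Real.sin ((1 + γ) * θ) ≤ 0 := by
      have := Real.sin_nonneg_of_nonneg_of_le_pi (x := (1 + γ) * θ - Real.pi) (by linarith)
        (by nlinarith)
      rw [Real.sin_sub_pi] at this
      linarith
    have h2 := mul_nonpos_of_nonneg_of_nonpos (Real.exp_pos (γ * x)).le h1
    have h3 := mul_nonneg (Real.exp_pos ((1 + γ) * x)).le hs'
    linarith

theorem exists_eq_add_mul_inv {V W : ℂ} (hV : 0 < V.im) (hVW : 0 ≤ (V * W).im)
    (hW : W.im ≤ 0) : ∃ α β : ℝ, 0 ≤ α ∧ 0 ≤ β ∧ W = α + β * V⁻¹ := by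
  refine ⟨(V * W).im / V.im, -(normSq V * W.im) / V.im, by positivity,
    div_nonneg (by have := mul_nonneg (normSq_nonneg V) (neg_nonneg.2 hW); linarith) hV.le, ?_⟩
  have hV0 : V ≠ 0 := by rintro rfl; simp at hV
  have key : W * V = ((V * W).im / V.im : ℝ) * V + (-(normSq V * W.im) / V.im : ℝ) := by
    apply Complex.ext
    · simp only [mul_re, add_re, ofReal_re, ofReal_im, mul_im, normSq_apply]
      field_simp
      ring
    · simp only [add_im, ofReal_re, ofReal_im, mul_im, normSq_apply]
      field_simp
      ring
  exact mul_right_cancel₀ hV0 (by rw [key, add_mul, mul_assoc, inv_mul_cancel₀ hV0, mul_one])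

theorem exp_difference_cone_of_im_pos {γ : ℝ} {d : ℂ} (hγ0 : 0 < γ) (hγ1 : γ ≤ 1)
    (h0 : 0 < d.im) (hpi : d.im < Real.pi) :
    ∃ α β : ℝ, 0 ≤ α ∧ 0 ≤ β ∧
      (1 - exp (γ * d)) = (1 - exp d) * (α + β * exp (-d)) := by
  obtain ⟨x, θ⟩ := d
  simp only at h0 hpi
  have hs := Real.sin_pos_of_pos_of_lt_pi h0 hpi
  have hVim : 0 < (exp (⟨x, θ⟩ : ℂ)).im := by
    rw [exp_im]; exact mul_pos (Real.exp_pos _) hs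
  have hne : 1 - exp (⟨x, θ⟩ : ℂ) ≠ 0 := by
    intro h
    rw [← sub_eq_zero.1 h] at hVim
    simp at hVim
  have hN : 0 < normSq (1 - exp (⟨x, θ⟩ : ℂ)) := normSq_pos.2 hne
  have hA : (exp (⟨x, θ⟩ : ℂ)).re = Real.exp x * Real.cos θ := exp_re _
  have hB : (exp (⟨x, θ⟩ : ℂ)).im = Real.exp x * Real.sin θ := exp_im _
  have hC : (exp (γ * ⟨x, θ⟩ : ℂ)).re = Real.exp (γ * x) * Real.cos (γ * θ) := by
    rw [exp_re]; simp
  have hD : (exp (γ * ⟨x, θ⟩ : ℂ)).im = Real.exp (γ * x) * Real.sin (γ * θ) := by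
    rw [exp_im]; simp
  have hW : (1 - exp (γ * ⟨x, θ⟩ : ℂ)) / (1 - exp (⟨x, θ⟩ : ℂ)) =
      ((1 / normSq (1 - exp (⟨x, θ⟩ : ℂ)) : ℝ) : ℂ) *
        ((1 - exp (γ * ⟨x, θ⟩ : ℂ)) * (starRingEnd ℂ) (1 - exp (⟨x, θ⟩ : ℂ))) := by
    rw [div_eq_mul_inv, Complex.inv_def]; push_cast; ring
  have e1 : Real.exp ((γ - 1) * x) * Real.exp x = Real.exp (γ * x) := by
    rw [← Real.exp_add]; ring_nf
  have e2 : Real.exp ((1 + γ) * x) = Real.exp (γ * x) * Real.exp x := by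
    rw [← Real.exp_add]; ring_nf
  have i1 := sin_le_exp_mul_sin_add x hγ0.le hγ1 h0.le hpi.le
  have i2 := exp_mul_sin_le_sin_add x hγ0.le hγ1 h0.le hpi.le
  rw [show (1 - γ) * θ = θ - γ * θ by ring, Real.sin_sub] at i1
  rw [show (1 + γ) * θ = θ + γ * θ by ring, Real.sin_add, e2] at i2
  have hex := Real.exp_pos x
  obtain ⟨α, β, hα, hβ, h⟩ := exists_eq_add_mul_inv (V := exp (⟨x, θ⟩ : ℂ))
    (W := (1 - exp (γ * ⟨x, θ⟩ : ℂ)) / (1 - exp (⟨x, θ⟩ : ℂ))) hVim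
    (by
      rw [hW, mul_left_comm, im_ofReal_mul]
      refine mul_nonneg (by positivity) ?_
      simp only [mul_im, mul_re, sub_re, sub_im, one_re, one_im, conj_re, conj_im, hA, hB, hC, hD]
      have := mul_le_mul_of_nonneg_left i2 hex.le
      have hc := Real.sin_sq_add_cos_sq θ
      linear_combination this - Real.exp x ^ 2 * Real.exp (γ * x) * Real.sin (γ * θ) * hc)
    (by
      rw [hW, im_ofReal_mul]
      refine mul_nonpos_of_nonneg_of_nonpos (by positivity) ?_
      simp only [mul_im, sub_re, sub_im, one_re, one_im, conj_re, conj_im, hA, hB, hC, hD]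
      have := mul_le_mul_of_nonneg_left i1 hex.le
      linear_combination this + Real.sin (γ * θ) * e1)
  refine ⟨α, β, hα, hβ, ?_⟩
  rw [exp_neg, ← h]
  field_simp

/-- For `|Im d| < π` and `0 < γ ≤ 1`, the quotient `(1 - e^{γd}) / (1 - e^d)` lies in the convex
cone spanned by `1` and `e^{-d}`. -/
theorem exp_difference_cone {γ : ℝ} {d : ℂ} (hγ0 : 0 < γ) (hγ1 : γ ≤ 1) (hd : |d.im| < Real.pi) :
    ∃ α β : ℝ, 0 ≤ α ∧ 0 ≤ β ∧
      (1 - exp (γ * d)) = (1 - exp d) * (α + β * exp (-d)) := by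
  rcases lt_trichotomy d.im 0 with h | h | h
  · obtain ⟨α, β, hα, hβ, e⟩ := exp_difference_cone_of_im_pos (d := (starRingEnd ℂ) d) hγ0 hγ1
      (by simpa using h) (by rw [conj_im]; linarith [(abs_lt.1 hd).1])
    refine ⟨α, β, hα, hβ, ?_⟩
    have := congrArg (starRingEnd ℂ) e
    simpa [← exp_conj] using this
  · obtain ⟨x, rfl⟩ : ∃ x : ℝ, d = x := ⟨d.re, Complex.ext rfl (by simpa using h)⟩
    refine ⟨(1 - Real.exp (γ * x)) / (1 - Real.exp x), 0, ?_, le_rfl, ?_⟩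
    · rcases le_total 0 x with hx | hx
      · exact div_nonneg_of_nonpos (sub_nonpos.2 (Real.one_le_exp (by positivity)))
          (sub_nonpos.2 (Real.one_le_exp hx))
      · exact div_nonneg (sub_nonneg.2 (Real.exp_le_one_iff.2
          (mul_nonpos_of_nonneg_of_nonpos hγ0.le hx))) (sub_nonneg.2 (Real.exp_le_one_iff.2 hx))
    · have hr : (1 - Real.exp (γ * x)) = (1 - Real.exp x) *
          ((1 - Real.exp (γ * x)) / (1 - Real.exp x)) := by
        rcases eq_or_ne x 0 with rfl | hx
        · simp
        · rw [mul_div_cancel₀]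
          rw [sub_ne_zero]
          intro h1
          exact hx (Real.exp_eq_one_iff x |>.1 h1.symm)
      have := congrArg (fun t : ℝ => (t : ℂ)) hr
      simpa using this
  · exact exp_difference_cone_of_im_pos hγ0 hγ1 h (abs_lt.1 hd).2

/-! ### The half-plane containing the image of the Moebius map -/

theorem re_mul_pos_of_norm_lt {b : ℝ} {c P : ℂ} (hb0 : 0 ≤ b) (hb1 : b ≤ 1) (hc : ‖c‖ = 1)
    (h : ‖P - 1‖ < ‖c + b * P‖) : 0 < ((1 + b * (starRingEnd ℂ) c) * P).re := by
  have h2 : normSq (P - 1) < normSq (c + b * P) := by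
    rw [normSq_eq_norm_sq, normSq_eq_norm_sq]
    gcongr
  have hc2 : normSq c = 1 := by rw [normSq_eq_norm_sq, hc, one_pow]
  simp only [normSq_apply, sub_re, sub_im, add_re, add_im, mul_re, mul_im, ofReal_re, ofReal_im,
    one_re, one_im, conj_re, conj_im] at *
  have : 0 ≤ (1 - b ^ 2) * (P.re ^ 2 + P.im ^ 2) :=
    mul_nonneg (by nlinarith) (by positivity)
  nlinarith

theorem one_add_mul_conj_re_pos {b : ℝ} {c : ℂ} (hb0 : 0 ≤ b) (hb1 : b ≤ 1) (hc : ‖c‖ = 1)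
    (hne : (b : ℂ) + c ≠ 0) : 0 < (1 + b * (starRingEnd ℂ) c).re := by
  have hc2 : normSq c = 1 := by rw [normSq_eq_norm_sq, hc, one_pow]
  simp only [normSq_apply, add_re, mul_re, ofReal_re, ofReal_im, one_re, conj_re, conj_im] at *
  have h1 : -1 ≤ c.re := by nlinarith [sq_nonneg c.im]
  by_contra hle
  have hb : b = 1 := by nlinarith
  have hre : c.re = -1 := by nlinarith
  have him : c.im = 0 := by rw [hre] at hc2; nlinarith
  exact hne (Complex.ext (by simp [hb, hre]) (by simp [him]))

theorem abs_arg_add_arg_lt {η P : ℂ} (hη : 0 < η.re) (h : 0 < (η * P).re) :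
    |arg P + arg η| < Real.pi / 2 := by
  have hη0 : η ≠ 0 := by rintro rfl; simp at hη
  have hP0 : P ≠ 0 := by rintro rfl; simp at h
  have h1 := abs_lt.1 (abs_arg_lt_pi_div_two_iff.2 (Or.inl hη))
  have h2 := neg_pi_lt_arg P
  have h3 := arg_le_pi P
  have hcos : 0 < Real.cos (arg P + arg η) := by
    rw [Real.cos_add, cos_arg hP0, cos_arg hη0, sin_arg, sin_arg]
    have : P.re / ‖P‖ * (η.re / ‖η‖) - P.im / ‖P‖ * (η.im / ‖η‖) =
        (η * P).re / (‖P‖ * ‖η‖) := by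
      rw [mul_re]; field_simp
    rw [this]
    have := norm_pos_iff.2 hη0
    have := norm_pos_iff.2 hP0
    positivity
  by_contra hle
  rw [not_lt] at hle
  have h4 := Real.cos_nonpos_of_pi_div_two_le_of_le hle
    (by rw [abs_le]; constructor <;> linarith)
  rw [Real.cos_abs] at h4
  linarith

theorem mem_slitPlane_of_re_mul_pos {η P : ℂ} (hη : 0 < η.re) (h : 0 < (η * P).re) :
    P ∈ slitPlane := by
  rw [mem_slitPlane_iff]
  by_contra! hP
  rw [mul_re, hP.2, mul_zero, sub_zero] at h
  nlinarith [mul_nonpos_of_nonneg_of_nonpos hη.le hP.1]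

/-! ### The Moebius map, its power, and the associated radial derivative -/

/-- The Moebius map `z ↦ (1 + cz) / (1 - bz)`. -/
noncomputable def moebius (b : ℝ) (c z : ℂ) : ℂ := (1 + c * z) / (1 - b * z)

/-- The principal `γ`-th power of the Moebius map. -/
noncomputable def powMoebius (γ b : ℝ) (c z : ℂ) : ℂ := moebius b c z ^ (γ : ℂ)

/-- The radial derivative `z q'(z)` of `q = powMoebius γ b c`. -/
noncomputable def radialPowMoebius (γ b : ℝ) (c z : ℂ) : ℂ :=
  γ * ((b + c) * z / ((1 + c * z) * (1 - b * z))) * powMoebius γ b c z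

section
variable {γ b : ℝ} {c z w ζ : ℂ}

theorem norm_ofReal_mul_lt_one (hb0 : 0 ≤ b) (hb1 : b ≤ 1) (hz : ‖z‖ < 1) : ‖(b : ℂ) * z‖ < 1 := by
  rw [norm_mul, norm_real, Real.norm_of_nonneg hb0]
  nlinarith [norm_nonneg z]

theorem one_sub_ofReal_mul_ne_zero (hb0 : 0 ≤ b) (hb1 : b ≤ 1) (hz : ‖z‖ < 1) :
    1 - (b : ℂ) * z ≠ 0 := by
  intro h
  have := norm_ofReal_mul_lt_one hb0 hb1 hz
  rw [← sub_eq_zero.1 h] at this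
  simp at this

theorem one_add_mul_ne_zero (hc : ‖c‖ = 1) (hz : ‖z‖ < 1) : 1 + c * z ≠ 0 := by
  intro h
  have h1 : ‖c * z‖ < 1 := by rwa [norm_mul, hc, one_mul]
  rw [eq_neg_of_add_eq_zero_right h] at h1
  simp at h1

theorem re_moebius_pos (hb0 : 0 ≤ b) (hb1 : b ≤ 1) (hc : ‖c‖ = 1) (hne : (b : ℂ) + c ≠ 0)
    (hz : ‖z‖ < 1) : 0 < ((1 + b * (starRingEnd ℂ) c) * moebius b c z).re := by
  refine re_mul_pos_of_norm_lt hb0 hb1 hc ?_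
  have h1 := one_sub_ofReal_mul_ne_zero hb0 hb1 hz
  have e1 : moebius b c z - 1 = (b + c) / (1 - b * z) * z := by
    rw [moebius, div_sub_one h1, div_mul_eq_mul_div]; congr 1; ring
  have e2 : c + b * moebius b c z = (b + c) / (1 - b * z) := by
    rw [moebius]; field_simp; ring
  rw [e1, e2, norm_mul]
  have : 0 < ‖((b : ℂ) + c) / (1 - b * z)‖ := norm_pos_iff.2 (div_ne_zero hne h1)
  nlinarith

theorem moebius_mem_slitPlane (hb0 : 0 ≤ b) (hb1 : b ≤ 1) (hc : ‖c‖ = 1) (hne : (b : ℂ) + c ≠ 0)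
    (hz : ‖z‖ < 1) : moebius b c z ∈ slitPlane :=
  mem_slitPlane_of_re_mul_pos (one_add_mul_conj_re_pos hb0 hb1 hc hne)
    (re_moebius_pos hb0 hb1 hc hne hz)

theorem powMoebius_eq_exp (hb0 : 0 ≤ b) (hb1 : b ≤ 1) (hc : ‖c‖ = 1) (hne : (b : ℂ) + c ≠ 0)
    (hz : ‖z‖ < 1) : powMoebius γ b c z = exp (γ * log (moebius b c z)) := by
  rw [powMoebius, cpow_def_of_ne_zero
    (slitPlane_ne_zero (moebius_mem_slitPlane hb0 hb1 hc hne hz)), mul_comm]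

theorem powMoebius_ne_zero (hb0 : 0 ≤ b) (hb1 : b ≤ 1) (hc : ‖c‖ = 1) (hne : (b : ℂ) + c ≠ 0)
    (hz : ‖z‖ < 1) : powMoebius γ b c z ≠ 0 := by
  rw [powMoebius_eq_exp hb0 hb1 hc hne hz]
  exact exp_ne_zero _

theorem hasDerivAt_powMoebius (hb0 : 0 ≤ b) (hb1 : b ≤ 1) (hc : ‖c‖ = 1)
    (hne : (b : ℂ) + c ≠ 0) (hz : ‖z‖ < 1) :
    HasDerivAt (powMoebius γ b c)
      (γ * ((b + c) / ((1 + c * z) * (1 - b * z))) * powMoebius γ b c z) z := by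
  have h1 := one_sub_ofReal_mul_ne_zero hb0 hb1 hz
  have h2 := one_add_mul_ne_zero hc hz
  have hU : HasDerivAt (moebius b c) ((b + c) / (1 - b * z) ^ 2) z := by
    have := ((((hasDerivAt_id z).const_mul c).const_add 1).div
      (((hasDerivAt_id z).const_mul (b : ℂ)).const_sub 1) h1)
    refine this.congr_deriv ?_
    simp only [id]
    field_simp
    ring
  have hs := moebius_mem_slitPlane hb0 hb1 hc hne hz
  have := hU.cpow_const (c := (γ : ℂ)) hs
  refine this.congr_deriv ?_
  rw [cpow_sub _ _ (slitPlane_ne_zero hs), cpow_one, powMoebius]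
  have e : moebius b c z = (1 + c * z) / (1 - b * z) := rfl
  generalize moebius b c z ^ (γ : ℂ) = T
  rw [e]
  field_simp

theorem hasDerivAt_radialPowMoebius (hb0 : 0 ≤ b) (hb1 : b ≤ 1) (hc : ‖c‖ = 1)
    (hne : (b : ℂ) + c ≠ 0) (hz : ‖z‖ < 1) :
    HasDerivAt (radialPowMoebius γ b c)
      (γ * ((b + c) / ((1 + c * z) * (1 - b * z))) * powMoebius γ b c z *
        (1 + (1 - γ) * (-(c * z) / (1 - -(c * z))) + (1 + γ) * (b * z / (1 - b * z)))) z := by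
  have h1 := one_sub_ofReal_mul_ne_zero hb0 hb1 hz
  have h2 := one_add_mul_ne_zero hc hz
  have hq := hasDerivAt_powMoebius (γ := γ) hb0 hb1 hc hne hz
  have hnum := (hasDerivAt_id z).const_mul ((b : ℂ) + c)
  have hden := (((hasDerivAt_id z).const_mul c).const_add 1).mul
      (((hasDerivAt_id z).const_mul (b : ℂ)).const_sub 1)
  have := ((hnum.div hden (mul_ne_zero h2 h1)).const_mul (γ : ℂ)).mul hq
  refine this.congr_deriv ?_
  rw [sub_neg_eq_add]
  simp only [id, Pi.mul_apply, Pi.div_apply]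
  generalize powMoebius γ b c z = T
  field_simp
  ring

theorem neg_half_lt_re_div {u : ℂ} (hu : ‖u‖ < 1) : -(1 / 2) < (u / (1 - u)).re := by
  have hne : 1 - u ≠ 0 := by
    intro h
    rw [← sub_eq_zero.1 h] at hu
    simp at hu
  have hN := normSq_pos.2 hne
  have h2 : normSq u < 1 := by rw [normSq_eq_norm_sq]; nlinarith [norm_nonneg u]
  rw [div_re, ← add_div, lt_div_iff₀ hN]
  simp only [normSq_apply, sub_re, sub_im, one_re, one_im] at *
  linarith

theorem neg_half_le_re_div {u : ℂ} (hu : ‖u‖ ≤ 1) (hu1 : u ≠ 1) :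
    -(1 / 2) ≤ (u / (1 - u)).re := by
  have hN := normSq_pos.2 (sub_ne_zero.2 hu1.symm)
  have h2 : normSq u ≤ 1 := by rw [normSq_eq_norm_sq]; nlinarith [norm_nonneg u]
  rw [div_re, ← add_div, le_div_iff₀ hN]
  simp only [normSq_apply, sub_re, sub_im, one_re, one_im] at *
  linarith

theorem inv_re_pos {u : ℂ} (hu : 0 < u.re) : 0 < u⁻¹.re := by
  have : u ≠ 0 := by rintro rfl; simp at hu
  rw [inv_re]
  exact div_pos hu (normSq_pos.2 this)

theorem radial_derivative_factor_re_pos (hγ0 : 0 < γ) (hγ1 : γ ≤ 1) (hb0 : 0 ≤ b) (hb1 : b ≤ 1)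
    (hc : ‖c‖ = 1) (hz : ‖z‖ < 1) :
    0 < (1 + (1 - γ : ℂ) * (-(c * z) / (1 - -(c * z))) + (1 + γ) * (b * z / (1 - b * z))).re := by
  have h1 := neg_half_lt_re_div (norm_ofReal_mul_lt_one hb0 hb1 hz)
  have h2 := neg_half_lt_re_div (u := -(c * z)) (by rwa [norm_neg, norm_mul, hc, one_mul])
  rw [show (1 - γ : ℂ) = ((1 - γ : ℝ) : ℂ) by push_cast; ring,
    show (1 + γ : ℂ) = ((1 + γ : ℝ) : ℂ) by push_cast; ring, add_re, add_re, re_ofReal_mul,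
    re_ofReal_mul, one_re]
  nlinarith

/-- Strict support inequality expressing that `powMoebius γ b c` is a convex function. -/
theorem re_sub_div_radial_pos (hγ0 : 0 < γ) (hγ1 : γ ≤ 1) (hb0 : 0 ≤ b) (hb1 : b ≤ 1)
    (hc : ‖c‖ = 1) (hne : (b : ℂ) + c ≠ 0) (hw : ‖w‖ ≤ ‖ζ‖) (hζ : ‖ζ‖ < 1) (hwζ : w ≠ ζ) :
    0 < ((powMoebius γ b c ζ - powMoebius γ b c w) / radialPowMoebius γ b c ζ).re := by
  have hw1 : ‖w‖ < 1 := hw.trans_lt hζ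
  have hζ0 : ζ ≠ 0 := by
    rintro rfl
    exact hwζ (norm_le_zero_iff.1 (by simpa using hw))
  have hγ : (γ : ℂ) ≠ 0 := ofReal_ne_zero.2 hγ0.ne'
  have a1 := one_sub_ofReal_mul_ne_zero hb0 hb1 hζ
  have a2 := one_add_mul_ne_zero hc hζ
  have a3 := one_sub_ofReal_mul_ne_zero hb0 hb1 hw1
  have a4 := one_add_mul_ne_zero hc hw1
  have a5 : ζ - w ≠ 0 := sub_ne_zero.2 hwζ.symm
  have hη := one_add_mul_conj_re_pos hb0 hb1 hc hne
  have r1 := abs_lt.1 (abs_arg_add_arg_lt hη (re_moebius_pos hb0 hb1 hc hne hw1))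
  have r2 := abs_lt.1 (abs_arg_add_arg_lt hη (re_moebius_pos hb0 hb1 hc hne hζ))
  set d := log (moebius b c w) - log (moebius b c ζ) with hd
  have hdim : |d.im| < Real.pi := by
    rw [hd, sub_im, log_im, log_im, abs_lt]
    constructor <;> linarith
  have hV : exp d = moebius b c w / moebius b c ζ := by
    rw [hd, exp_sub, exp_log (slitPlane_ne_zero (moebius_mem_slitPlane hb0 hb1 hc hne hw1)),
      exp_log (slitPlane_ne_zero (moebius_mem_slitPlane hb0 hb1 hc hne hζ))]
  have hT : powMoebius γ b c w = powMoebius γ b c ζ * exp (γ * d) := by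
    rw [powMoebius_eq_exp hb0 hb1 hc hne hw1, powMoebius_eq_exp hb0 hb1 hc hne hζ, ← exp_add, hd]
    ring_nf
  have hV1 : 1 - exp d = (b + c) * (ζ - w) / ((1 - b * w) * (1 + c * ζ)) := by
    rw [hV, moebius, moebius, div_div_div_eq, one_sub_div (mul_ne_zero a3 a2)]
    congr 1
    ring
  have hTne : 1 - exp (γ * d) ≠ 0 := by
    intro h
    have h0 : (γ * d : ℂ) = 0 := by
      refine exp_inj_of_neg_pi_lt_of_le_pi (y := 0) ?_ ?_ (by simp [Real.pi_pos])
        (by simp [Real.pi_pos.le]) ?_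
      · rw [im_ofReal_mul]; nlinarith [(abs_lt.1 hdim).1, (abs_lt.1 hdim).2]
      · rw [im_ofReal_mul]; nlinarith [(abs_lt.1 hdim).1, (abs_lt.1 hdim).2]
      · rw [exp_zero, ← sub_eq_zero.1 h]
    have h1 : d = 0 := (mul_eq_zero.1 h0).resolve_left hγ
    rw [h1, exp_zero, sub_self] at hV1
    exact div_ne_zero (mul_ne_zero hne a5) (mul_ne_zero a3 a2) hV1.symm
  obtain ⟨α, β, hα, hβ, e⟩ := exp_difference_cone hγ0 hγ1 hdim
  have hx : -(1 / 2) ≤ ((w / ζ) / (1 - w / ζ)).re := by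
    refine neg_half_le_re_div ?_ ?_
    · rw [norm_div]
      exact div_le_one_of_le₀ hw (norm_nonneg _)
    · rwa [Ne, div_eq_one_iff_eq hζ0]
  have hbz := neg_half_lt_re_div (norm_ofReal_mul_lt_one hb0 hb1 hζ)
  have hcz := neg_half_lt_re_div (u := -(c * ζ)) (by rwa [norm_neg, norm_mul, hc, one_mul])
  have k1 := inv_re_pos (u := 1 + (w / ζ) / (1 - w / ζ) + b * ζ / (1 - b * ζ)) (by
    rw [add_re, add_re, one_re]; linarith)
  have k2 := inv_re_pos (u := 1 + (w / ζ) / (1 - w / ζ) + -(c * ζ) / (1 - -(c * ζ))) (by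
    rw [add_re, add_re, one_re]; linarith)
  have f1 : 1 + (w / ζ) / (1 - w / ζ) = ζ / (ζ - w) := by
    have : 1 - w / ζ ≠ 0 := by
      rw [one_sub_div hζ0]; exact div_ne_zero a5 hζ0
    field_simp
    ring
  have g1 : 1 + (w / ζ) / (1 - w / ζ) + b * ζ / (1 - b * ζ) =
      ζ * (1 - b * w) / ((ζ - w) * (1 - b * ζ)) := by
    rw [f1, div_add_div _ _ a5 a1]; congr 1; ring
  have g2 : 1 + (w / ζ) / (1 - w / ζ) + -(c * ζ) / (1 - -(c * ζ)) =
      ζ * (1 + c * w) / ((ζ - w) * (1 + c * ζ)) := by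
    rw [f1, sub_neg_eq_add, div_add_div _ _ a5 a2]; congr 1; ring
  rw [g1] at k1
  rw [g2] at k2
  have key : (powMoebius γ b c ζ - powMoebius γ b c w) / radialPowMoebius γ b c ζ =
      ((1 / γ : ℝ) : ℂ) * ((α : ℂ) * (ζ * (1 - b * w) / ((ζ - w) * (1 - b * ζ)))⁻¹ +
        (β : ℂ) * (ζ * (1 + c * w) / ((ζ - w) * (1 + c * ζ)))⁻¹) := by
    have hq0 := powMoebius_ne_zero (γ := γ) hb0 hb1 hc hne hζ
    rw [hT, radialPowMoebius, ← mul_one_sub, e, hV1, exp_neg, hV, moebius, moebius]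
    push_cast
    field_simp
  rw [key, re_ofReal_mul, add_re, re_ofReal_mul, re_ofReal_mul]
  refine mul_pos (by positivity) ?_
  rcases hα.eq_or_lt with h0 | h0
  · rcases hβ.eq_or_lt with h1 | h1
    · rw [← h0, ← h1] at e
      exact absurd (by simpa using e) hTne
    · have := mul_pos h1 k2
      have := mul_nonneg hα k1.le
      linarith
  · have := mul_pos h0 k1
    have := mul_nonneg hβ k2.le
    linarith

end

/-! ### Jack's lemma -/

/-- **Jack's lemma.** If `f` is holomorphic on a disk, vanishes at the centre, and its modulus on
the disk is bounded by its modulus at a boundary point `z₀`, then `z₀ f'(z₀)` is a real multiple of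
`f z₀` with factor at least one. -/
theorem exists_one_le_mul_deriv_eq {f : ℂ → ℂ} {z₀ D : ℂ} (hz₀ : z₀ ≠ 0)
    (hd : DifferentiableOn ℂ f (Metric.ball 0 ‖z₀‖)) (hf : HasDerivAt f D z₀) (h0 : f 0 = 0)
    (hle : ∀ z, ‖z‖ < ‖z₀‖ → ‖f z‖ ≤ ‖f z₀‖) (hne : f z₀ ≠ 0) :
    ∃ s : ℝ, 1 ≤ s ∧ z₀ * D = s * f z₀ := by
  have hz₀' : 0 < ‖z₀‖ := norm_pos_iff.2 hz₀
  have schwarz : ∀ z, ‖z‖ < ‖z₀‖ → ‖f z‖ ≤ ‖f z₀‖ / ‖z₀‖ * ‖z‖ := by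
    intro z hz
    have := dist_le_div_mul_dist_of_mapsTo_ball (f := f) (c := 0) (z := z) (R₁ := ‖z₀‖)
      (R₂ := ‖f z₀‖) hd (fun w hw => by
        rw [h0, mem_closedBall_zero_iff]
        exact hle w (mem_ball_zero_iff.1 hw)) (mem_ball_zero_iff.2 hz)
    simpa [h0] using this
  set τ := z₀ * D / f z₀ - 1 with hτ
  have key : ∀ a : ℂ, 0 < a.re → 0 ≤ (a * τ).re := by
    intro a ha
    have hlin : HasDerivAt (fun t : ℝ => 1 - (t : ℂ) * a) (-a) 0 := by
      simpa using ((ofRealCLM.hasDerivAt (x := (0 : ℝ))).mul_const a).const_sub 1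
    have hinner : HasDerivAt (fun t : ℝ => z₀ * (1 - (t : ℂ) * a)) (z₀ * -a) 0 :=
      hlin.const_mul z₀
    have hcomp : HasDerivAt (fun t : ℝ => f (z₀ * (1 - (t : ℂ) * a))) (D * (z₀ * -a)) 0 := by
      have hf' : HasDerivAt f D (z₀ * (1 - ((0 : ℝ) : ℂ) * a)) := by simpa using hf
      exact hf'.comp (0 : ℝ) hinner
    have hquot := hcomp.div (hlin.const_mul (f z₀)) (by simpa using hne)
    have hre := (reCLM.hasFDerivAt.comp_hasDerivAt (0 : ℝ) hquot)
    have hslope := hre.tendsto_slope_zero_right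
    have hnorm : ∀ᶠ t : ℝ in nhdsWithin 0 (Set.Ioi 0), ‖1 - (t : ℂ) * a‖ < 1 := by
      have hev : ∀ᶠ t : ℝ in nhdsWithin 0 (Set.Ioi 0), t * normSq a < 2 * a.re := by
        refine nhdsWithin_le_nhds ?_
        have : Filter.Tendsto (fun t : ℝ => t * normSq a) (nhds 0) (nhds (0 * normSq a)) :=
          (continuous_id.mul continuous_const).tendsto 0
        rw [zero_mul] at this
        exact this.eventually_lt_const (by linarith)
      filter_upwards [hev, self_mem_nhdsWithin] with t ht ht0
      have ht0 : 0 < t := ht0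
      have : normSq (1 - (t : ℂ) * a) < 1 := by
        simp only [normSq_apply, sub_re, sub_im, re_ofReal_mul, im_ofReal_mul, one_re,
          one_im] at *
        nlinarith
      rw [normSq_eq_norm_sq] at this
      nlinarith [norm_nonneg (1 - (t : ℂ) * a)]
    have hlim := le_of_tendsto hslope (b := 0) (by
      filter_upwards [hnorm, self_mem_nhdsWithin] with t ht ht0
      have ht0 : 0 < t := ht0
      have hb := schwarz (z₀ * (1 - (t : ℂ) * a)) (by
        rw [norm_mul]; nlinarith)
      have h1 : ‖f (z₀ * (1 - (t : ℂ) * a)) / (f z₀ * (1 - (t : ℂ) * a))‖ ≤ 1 := by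
        rw [norm_div, norm_mul]
        refine div_le_one_of_le₀ (hb.trans_eq ?_) (by positivity)
        rw [norm_mul]; field_simp
      have h2 := (re_le_norm _).trans h1
      simp only [zero_add, Function.comp_apply, Pi.div_apply, smul_eq_mul, ofReal_zero, zero_mul,
        sub_zero, mul_one, div_self hne, reCLM_apply, one_re]
      exact mul_nonpos_of_nonneg_of_nonpos (inv_nonneg.2 ht0.le) (sub_nonpos.2 h2))
    have e : (D * (z₀ * -a) * (f z₀ * (1 - ((0 : ℝ) : ℂ) * a)) -
        f (z₀ * (1 - ((0 : ℝ) : ℂ) * a)) * (f z₀ * -a)) / (f z₀ * (1 - ((0 : ℝ) : ℂ) * a)) ^ 2 =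
        -(a * τ) := by
      rw [hτ]
      simp only [ofReal_zero, zero_mul, sub_zero, mul_one]
      field_simp
      ring
    rw [e, reCLM_apply, neg_re] at hlim
    linarith
  have hre : 0 ≤ τ.re := by simpa using key 1 (by simp)
  have him : τ.im = 0 := by
    by_contra h
    have := key ⟨1, (τ.re + 1) / τ.im⟩ (by simp)
    rw [mul_re] at this
    simp only [one_mul, div_mul_cancel₀ _ h] at this
    linarith
  refine ⟨τ.re + 1, by linarith, ?_⟩
  have : (τ.re : ℂ) = τ := Complex.ext rfl (by simp [him])
  push_cast
  rw [this, hτ]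
  field_simp
  ring

/-! ### Monotonicity of the radial derivative of a convex function -/

/-- If `q` satisfies the support inequality characterising convex functions, then the radial
derivative `N`, seen as a function of `q`, is monotone. -/
theorem re_sub_div_sub_pos {q N : ℂ → ℂ} {q' N' w ζ : ℂ}
    (hq : DifferentiableOn ℂ q (Metric.ball 0 1)) (hN : DifferentiableOn ℂ N (Metric.ball 0 1))
    (hconv : ∀ u v : ℂ, ‖u‖ ≤ ‖v‖ → ‖v‖ < 1 → u ≠ v → 0 < ((q v - q u) / N v).re)
    (hζ : ‖ζ‖ < 1) (hwζ : ‖w‖ < ‖ζ‖) (hqd : HasDerivAt q q' ζ) (hNd : HasDerivAt N N' ζ)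
    (hq'0 : q' ≠ 0) (hpos : 0 < (N' / q').re) : 0 < ((N w - N ζ) / (q w - q ζ)).re := by
  have hball : Metric.ball (0 : ℂ) 1 ∈ nhds ζ :=
    Metric.isOpen_ball.mem_nhds (mem_ball_zero_iff.2 hζ)
  have hinj : ∀ u, ‖u‖ < 1 → u ≠ ζ → q u ≠ q ζ := by
    intro u hu hne h
    rcases le_total ‖u‖ ‖ζ‖ with hle | hle
    · have := hconv u ζ hle hζ hne
      rw [h, sub_self, zero_div] at this
      simp at this
    · have := hconv ζ u hle hu hne.symm
      rw [h, sub_self, zero_div] at this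
      simp at this
  have hslope : ∀ u, u ≠ ζ →
      dslope N ζ u / dslope q ζ u = (N u - N ζ) / (q u - q ζ) := by
    intro u hne
    have : u - ζ ≠ 0 := sub_ne_zero.2 hne
    rw [dslope_of_ne _ hne, dslope_of_ne _ hne, slope_def_field, slope_def_field]
    field_simp
  have hdq0 : ∀ u ∈ Metric.ball (0 : ℂ) 1, dslope q ζ u ≠ 0 := by
    intro u hu
    rcases eq_or_ne u ζ with rfl | hne
    · rwa [dslope_same, hqd.deriv]
    · rw [dslope_of_ne _ hne, slope_def_field]
      exact div_ne_zero (sub_ne_zero.2 (hinj u (mem_ball_zero_iff.1 hu) hne))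
        (sub_ne_zero.2 hne)
  have hg : DifferentiableOn ℂ (fun u => dslope N ζ u / dslope q ζ u) (Metric.ball 0 1) :=
    ((differentiableOn_dslope hball).2 hN).div ((differentiableOn_dslope hball).2 hq) hdq0
  have hsph : ∀ u ∈ Metric.sphere (0 : ℂ) ‖ζ‖, 0 < (dslope N ζ u / dslope q ζ u).re := by
    intro u hu
    rw [mem_sphere_zero_iff_norm] at hu
    rcases eq_or_ne u ζ with rfl | hne
    · rwa [dslope_same, dslope_same, hqd.deriv, hNd.deriv]
    · rw [hslope u hne]
      have h1 := inv_re_pos (hconv u ζ hu.le hζ hne)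
      have h2 := inv_re_pos (hconv ζ u hu.ge (hu.trans_lt hζ) hne.symm)
      rw [inv_div] at h1 h2
      have e : (N u - N ζ) / (q u - q ζ) = N ζ / (q ζ - q u) + N u / (q u - q ζ) := by
        rw [← neg_sub (q u) (q ζ), div_neg]; ring
      rw [e, add_re]
      exact add_pos h1 h2
  have hsub : Metric.closedBall (0 : ℂ) ‖ζ‖ ⊆ Metric.ball 0 1 :=
    Metric.closedBall_subset_ball hζ
  have hζ0 : ‖ζ‖ ≠ 0 := ((norm_nonneg w).trans_lt hwζ).ne'
  obtain ⟨u₀, hu₀, hmin⟩ := (isCompact_sphere (0 : ℂ) ‖ζ‖).exists_isMinOn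
    ⟨ζ, mem_sphere_zero_iff_norm.2 rfl⟩
    (continuous_re.comp_continuousOn
      (hg.continuousOn.mono (Metric.sphere_subset_closedBall.trans hsub)))
  have hF : DiffContOnCl ℂ (fun u => exp (-(dslope N ζ u / dslope q ζ u)))
      (Metric.ball 0 ‖ζ‖) := by
    refine DifferentiableOn.diffContOnCl ?_
    rw [closure_ball _ hζ0]
    exact (hg.mono hsub).neg.cexp
  have hmax := norm_le_of_forall_mem_frontier_norm_le Metric.isBounded_ball hF
    (C := Real.exp (-(dslope N ζ u₀ / dslope q ζ u₀).re)) (fun u hu => by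
      rw [frontier_ball _ hζ0] at hu
      rw [norm_exp, neg_re, Real.exp_le_exp, neg_le_neg_iff]
      exact hmin hu) (subset_closure (mem_ball_zero_iff.2 hwζ))
  rw [norm_exp, neg_re, Real.exp_le_exp, neg_le_neg_iff, hslope w (by rintro rfl; simp at hwζ)]
    at hmax
  exact (hsph u₀ hu₀).trans_le hmax

/-- At a first point of contact the differential subordination is violated. -/
theorem radial_combination_ne {γ b lam s : ℝ} {c w ζ : ℂ} (hγ0 : 0 < γ) (hγ1 : γ ≤ 1)
    (hb0 : 0 ≤ b) (hb1 : b ≤ 1) (hc : ‖c‖ = 1) (hne : (b : ℂ) + c ≠ 0) (hlam0 : 0 < lam)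
    (hlam1 : lam ≤ 1) (hs : 1 ≤ s) (hwζ : ‖w‖ < ‖ζ‖) (hζ : ‖ζ‖ < 1) :
    (1 - lam : ℂ) * powMoebius γ b c w + lam * radialPowMoebius γ b c w ≠
      (1 - lam) * powMoebius γ b c ζ + lam * (s * radialPowMoebius γ b c ζ) := by
  intro heq
  have hdq : ∀ z : ℂ, ‖z‖ < 1 → HasDerivAt (powMoebius γ b c) _ z := fun z hz =>
    hasDerivAt_powMoebius (γ := γ) hb0 hb1 hc hne hz
  have hdN : ∀ z : ℂ, ‖z‖ < 1 → HasDerivAt (radialPowMoebius γ b c) _ z := fun z hz =>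
    hasDerivAt_radialPowMoebius (γ := γ) hb0 hb1 hc hne hz
  have hq'0 : (γ : ℂ) * ((b + c) / ((1 + c * ζ) * (1 - b * ζ))) * powMoebius γ b c ζ ≠ 0 :=
    mul_ne_zero (mul_ne_zero (ofReal_ne_zero.2 hγ0.ne') (div_ne_zero hne
      (mul_ne_zero (one_add_mul_ne_zero hc hζ) (one_sub_ofReal_mul_ne_zero hb0 hb1 hζ))))
      (powMoebius_ne_zero hb0 hb1 hc hne hζ)
  have hwne : w ≠ ζ := by rintro rfl; simp at hwζ
  have hB := re_sub_div_sub_pos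
    (fun z hz => (hdq z (mem_ball_zero_iff.1 hz)).differentiableAt.differentiableWithinAt)
    (fun z hz => (hdN z (mem_ball_zero_iff.1 hz)).differentiableAt.differentiableWithinAt)
    (fun u v h1 h2 h3 => re_sub_div_radial_pos hγ0 hγ1 hb0 hb1 hc hne h1 h2 h3)
    hζ hwζ (hdq ζ hζ) (hdN ζ hζ) hq'0 (by
      rw [mul_div_cancel_left₀ _ hq'0]
      exact radial_derivative_factor_re_pos hγ0 hγ1 hb0 hb1 hc hζ)
  have hA := re_sub_div_radial_pos hγ0 hγ1 hb0 hb1 hc hne hwζ.le hζ hwne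
  have hA' := inv_re_pos hA
  rw [inv_div] at hA'
  have hD : powMoebius γ b c ζ - powMoebius γ b c w ≠ 0 := by
    intro h
    rw [h, zero_div] at hA
    simp at hA
  have e : ((1 - lam : ℝ) : ℂ) +
      (lam : ℂ) * ((radialPowMoebius γ b c w - radialPowMoebius γ b c ζ) /
      (powMoebius γ b c w - powMoebius γ b c ζ)) = ((-(lam * (s - 1)) : ℝ) : ℂ) *
      (radialPowMoebius γ b c ζ / (powMoebius γ b c ζ - powMoebius γ b c w)) := by
    rw [← neg_sub (powMoebius γ b c ζ) (powMoebius γ b c w), div_neg]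
    push_cast
    field_simp
    linear_combination -heq
  have e2 := congrArg re e
  rw [add_re, ofReal_re, re_ofReal_mul, re_ofReal_mul] at e2
  have := mul_pos hlam0 hB
  have := mul_nonneg (mul_nonneg hlam0.le (sub_nonneg.2 hs)) hA'.le
  linarith

/-! ### Holomorphic logarithms on the disk -/

/-- A zero-free holomorphic function on the unit disk with value one at the origin has a
holomorphic logarithm vanishing at the origin. -/
theorem exists_exp_eq_of_ne_zero {p : ℂ → ℂ} (hp : DifferentiableOn ℂ p (Metric.ball 0 1))
    (hp0 : p 0 = 1) (hpne : ∀ z ∈ Metric.ball (0 : ℂ) 1, p z ≠ 0) :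
    ∃ l : ℂ → ℂ, l 0 = 0 ∧ (∀ z ∈ Metric.ball (0 : ℂ) 1, HasDerivAt l (deriv p z / p z) z) ∧
      ∀ z ∈ Metric.ball (0 : ℂ) 1, exp (l z) = p z := by
  obtain ⟨l, hl0, hl⟩ :=
    ((hp.deriv Metric.isOpen_ball).div hp hpne).isExactOn_ball.with_val_at 0 0
  refine ⟨l, hl0, hl, fun z hz => ?_⟩
  have hder : ∀ u ∈ Metric.ball (0 : ℂ) 1, HasDerivAt (fun u => p u * exp (-l u)) 0 u := by
    intro u hu
    have h1 := (hp.differentiableAt (Metric.isOpen_ball.mem_nhds hu)).hasDerivAt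
    have h2 : HasDerivAt l (deriv p u / p u) u := hl u hu
    have := h1.mul h2.neg.cexp
    refine this.congr_deriv ?_
    have := hpne u hu
    simp only [Pi.neg_apply]
    field_simp
    ring
  have := Metric.isOpen_ball.is_const_of_deriv_eq_zero (convex_ball (0 : ℂ) 1).isPreconnected
    (fun u hu => (hder u hu).differentiableAt.differentiableWithinAt)
    (fun u hu => (hder u hu).deriv) hz (Metric.mem_ball_self one_pos)
  simp only [hp0, hl0, neg_zero, exp_zero, mul_one, exp_neg] at this
  exact ((mul_inv_eq_one₀ (exp_ne_zero _)).1 this).symm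

/-- If `exp ∘ g` avoids the branch cut along the segment from the origin to `z` and `g 0 = 0`, then
the principal logarithm inverts the exponential at `g z`. -/
theorem log_exp_eq_of_segment {g : ℂ → ℂ} {z : ℂ}
    (hg : ∀ t ∈ Set.Icc (0 : ℝ) 1, DifferentiableAt ℂ g (t * z)) (h0 : g 0 = 0)
    (hs : ∀ t ∈ Set.Icc (0 : ℝ) 1, exp (g (t * z)) ∈ slitPlane) : log (exp (g z)) = g z := by
  have hder : ∀ t ∈ Set.Icc (0 : ℝ) 1,
      HasDerivAt (fun t : ℝ => log (exp (g (t * z))) - g (t * z)) 0 t := by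
    intro t ht
    have hlin : HasDerivAt (fun t : ℝ => (t : ℂ) * z) z t := by
      simpa using (ofRealCLM.hasDerivAt (x := t)).mul_const z
    have h1 : HasDerivAt (fun t : ℝ => g (t * z)) (deriv g (t * z) * z) t :=
      (hg t ht).hasDerivAt.comp t hlin
    have h2 := (h1.cexp.clog_real (hs t ht)).sub h1
    refine h2.congr_deriv ?_
    rw [mul_div_cancel_left₀ _ (exp_ne_zero _), sub_self]
  have := constant_of_has_deriv_right_zero
    (fun t ht => (hder t ht).continuousAt.continuousWithinAt)
    (fun t ht => (hder t ⟨ht.1, ht.2.le⟩).hasDerivWithinAt) 1 (by simp)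
  simp only [ofReal_one, one_mul, ofReal_zero, zero_mul, h0, exp_zero, log_one, sub_zero] at this
  exact sub_eq_zero.1 this

/-- The differential subordination forces `exp (l / γ)` into the image of the Moebius map. -/
theorem norm_exp_sub_one_lt {γ b lam : ℝ} {c : ℂ} {p l ω : ℂ → ℂ} (hγ0 : 0 < γ) (hγ1 : γ ≤ 1)
    (hb0 : 0 ≤ b) (hb1 : b ≤ 1) (hc : ‖c‖ = 1) (hne : (b : ℂ) + c ≠ 0) (hlam0 : 0 < lam)
    (hlam1 : lam ≤ 1) (hl0 : l 0 = 0)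
    (hl : ∀ z ∈ Metric.ball (0 : ℂ) 1, HasDerivAt l (deriv p z / p z) z)
    (hlp : ∀ z ∈ Metric.ball (0 : ℂ) 1, exp (l z) = p z)
    (hω : ∀ z : ℂ, ‖z‖ < 1 → ‖ω z‖ ≤ ‖z‖)
    (heq : ∀ z ∈ Metric.ball (0 : ℂ) 1, (1 - lam : ℂ) * p z + lam * z * deriv p z =
      (1 - lam) * powMoebius γ b c (ω z) + lam * radialPowMoebius γ b c (ω z))
    {z : ℂ} (hz : ‖z‖ < 1) : ‖exp (l z / γ) - 1‖ < ‖c + b * exp (l z / γ)‖ := by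
  by_contra hcon
  rw [not_lt] at hcon
  set P : ℂ → ℂ := fun u => exp (l u / γ) with hP
  have hPd : ∀ u : ℂ, ‖u‖ < 1 → HasDerivAt P (P u * (deriv p u / p u / γ)) u := fun u hu =>
    ((hl u (mem_ball_zero_iff.2 hu)).div_const (γ : ℂ)).cexp
  obtain ⟨ρ, hρ1, hρ2⟩ := exists_between hz
  set ψ : ℂ → ℝ := fun u => ‖P u - 1‖ - ρ * ‖c + b * P u‖ with hψ
  have hψc : ContinuousOn ψ (Metric.closedBall 0 ‖z‖) := by
    have hPc : ContinuousOn P (Metric.closedBall 0 ‖z‖) := fun u hu =>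
      (hPd u ((mem_closedBall_zero_iff.1 hu).trans_lt hz)).continuousAt.continuousWithinAt
    fun_prop
  have hAclosed := hψc.preimage_isClosed_of_isClosed Metric.isClosed_closedBall
    (isClosed_Ici (a := (0 : ℝ)))
  have hAcompact := (isCompact_closedBall (0 : ℂ) ‖z‖).of_isClosed_subset hAclosed
    Set.inter_subset_left
  obtain ⟨z₀, ⟨hz₀b, hz₀ψ⟩, hmin⟩ := hAcompact.exists_isMinOn
    ⟨z, by simp, by
      have := norm_nonneg (c + b * P z)
      simp only [Set.mem_preimage, Set.mem_Ici, hψ]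
      nlinarith⟩ continuous_norm.continuousOn
  rw [mem_closedBall_zero_iff] at hz₀b
  have hz₀1 : ‖z₀‖ < 1 := hz₀b.trans_lt hz
  have hz₀ψ : 0 ≤ ψ z₀ := hz₀ψ
  have hbefore : ∀ u, ‖u‖ < ‖z₀‖ → ψ u < 0 := by
    intro u hu
    by_contra h
    exact absurd (hmin ⟨mem_closedBall_zero_iff.2 (hu.le.trans hz₀b), not_lt.1 h⟩) (not_le.2 hu)
  have hρ0 : 0 < ρ := (norm_nonneg z).trans_lt hρ1
  have hz₀ : z₀ ≠ 0 := by
    rintro rfl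
    have : P 0 = 1 := by simp [hP, hl0]
    have h2 : 0 < ‖c + b‖ := norm_pos_iff.2 (by rwa [add_comm])
    simp only [hψ, this, sub_self, norm_zero, mul_one] at hz₀ψ
    nlinarith
  have hball : closure (Metric.ball (0 : ℂ) ‖z₀‖) = Metric.closedBall 0 ‖z₀‖ :=
    closure_ball _ (norm_ne_zero_iff.2 hz₀)
  have hle : ∀ u, ‖u‖ ≤ ‖z₀‖ → ψ u ≤ 0 := by
    intro u hu
    refine le_on_closure (s := Metric.ball (0 : ℂ) ‖z₀‖) (f := ψ) (g := fun _ => 0)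
      (fun v hv => (hbefore v (mem_ball_zero_iff.1 hv)).le) ?_ continuousOn_const ?_
    · rw [hball]
      exact hψc.mono (Metric.closedBall_subset_closedBall hz₀b)
    · rw [hball]
      exact mem_closedBall_zero_iff.2 hu
  have hK : ∀ u, ‖u‖ ≤ ‖z₀‖ → c + b * P u ≠ 0 := by
    intro u hu h
    have h1 := hle u hu
    simp only [hψ, h, norm_zero, mul_zero, sub_zero] at h1
    have h2 : P u = 1 := sub_eq_zero.1 (norm_le_zero_iff.1 h1)
    rw [h2, mul_one, add_comm] at h
    exact hne h
  have hlt : ∀ u, ‖u‖ ≤ ‖z₀‖ → ‖P u - 1‖ < ‖c + b * P u‖ := by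
    intro u hu
    have h1 := hle u hu
    have h2 := norm_pos_iff.2 (hK u hu)
    simp only [hψ] at h1
    nlinarith
  set f : ℂ → ℂ := fun u => (P u - 1) / (c + b * P u) with hf
  have hfd : ∀ u, ‖u‖ ≤ ‖z₀‖ → HasDerivAt f
      (P u * (deriv p u / p u / γ) * (b + c) / (c + b * P u) ^ 2) u := by
    intro u hu
    have h1 := hPd u (hu.trans_lt hz₀1)
    have h2 := (h1.sub_const 1).div ((h1.const_mul (b : ℂ)).const_add c) (hK u hu)
    refine h2.congr_deriv ?_
    congr 1
    ring
  have hfle : ∀ u, ‖u‖ ≤ ‖z₀‖ → ‖f u‖ ≤ ρ := by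
    intro u hu
    have h1 := hle u hu
    simp only [hψ] at h1
    simp only [hf, norm_div]
    rw [div_le_iff₀ (norm_pos_iff.2 (hK u hu))]
    linarith
  have hf₀ : ‖f z₀‖ = ρ := by
    refine le_antisymm (hfle z₀ le_rfl) ?_
    simp only [hψ] at hz₀ψ
    simp only [hf, norm_div]
    rw [le_div_iff₀ (norm_pos_iff.2 (hK z₀ le_rfl))]
    linarith
  obtain ⟨s, hs, hjack⟩ := exists_one_le_mul_deriv_eq hz₀
    (fun u hu => (hfd u (mem_ball_zero_iff.1 hu).le).differentiableAt.differentiableWithinAt)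
    (hfd z₀ le_rfl) (by simp [hf, hP, hl0]) (fun u hu => (hfle u hu.le).trans_eq hf₀.symm)
    (norm_pos_iff.1 (hf₀ ▸ hρ0))
  have hη := one_add_mul_conj_re_pos hb0 hb1 hc hne
  have hseg : ∀ t ∈ Set.Icc (0 : ℝ) 1, ‖(t : ℂ) * z₀‖ ≤ ‖z₀‖ := by
    intro t ht
    rw [norm_mul, norm_real, Real.norm_of_nonneg ht.1]
    exact mul_le_of_le_one_left (norm_nonneg _) ht.2
  have hlog : log (P z₀) = l z₀ / γ := log_exp_eq_of_segment (g := fun u => l u / γ)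
    (fun t ht => ((hl _ (mem_ball_zero_iff.2
      ((hseg t ht).trans_lt hz₀1))).div_const (γ : ℂ)).differentiableAt) (by simp [hl0])
    (fun t ht => mem_slitPlane_of_re_mul_pos hη
      (re_mul_pos_of_norm_lt hb0 hb1 hc (hlt _ (hseg t ht))))
  have hK₀ := hK z₀ le_rfl
  have hP₀ : P z₀ ≠ 0 := exp_ne_zero _
  have hγ : (γ : ℂ) ≠ 0 := ofReal_ne_zero.2 hγ0.ne'
  have hz₀m : z₀ ∈ Metric.ball (0 : ℂ) 1 := mem_ball_zero_iff.2 hz₀1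
  have hp₀ : p z₀ ≠ 0 := by rw [← hlp z₀ hz₀m]; exact exp_ne_zero _
  have e1 : 1 + c * f z₀ = (b + c) * P z₀ / (c + b * P z₀) := by
    rw [eq_div_iff hK₀, add_mul, mul_assoc, div_mul_cancel₀ _ hK₀]; ring
  have e2 : 1 - b * f z₀ = (b + c) / (c + b * P z₀) := by
    rw [eq_div_iff hK₀, sub_mul, mul_assoc, div_mul_cancel₀ _ hK₀]; ring
  have hm : moebius b c (f z₀) = P z₀ := by
    rw [moebius, e1, e2, div_div_div_cancel_right₀ hK₀, mul_div_cancel_left₀ _ hne]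
  have hq : powMoebius γ b c (f z₀) = p z₀ := by
    rw [powMoebius, hm, cpow_def_of_ne_zero hP₀, hlog, div_mul_cancel₀ _ hγ, hlp z₀ hz₀m]
  have hN : s * radialPowMoebius γ b c (f z₀) = z₀ * deriv p z₀ := by
    have : (s : ℂ) * radialPowMoebius γ b c (f z₀) =
        γ * ((b + c) * (s * f z₀) / ((1 + c * f z₀) * (1 - b * f z₀))) * p z₀ := by
      rw [radialPowMoebius, hq]; ring
    rw [this, e1, e2, ← hjack]
    generalize c + b * P z₀ = K at *
    field_simp
  refine radial_combination_ne (w := ω z₀) (ζ := f z₀) hγ0 hγ1 hb0 hb1 hc hne hlam0 hlam1 hs ?_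
    (hf₀ ▸ hρ2) ?_
  · rw [hf₀]
    exact ((hω z₀ hz₀1).trans hz₀b).trans_lt hρ1
  · rw [← heq z₀ hz₀m, hq, hN]
    ring

theorem re_exp_neg_arctan_mul_pos {x y : ℝ} {P : ℂ} (hx : 0 < x)
    (h : 0 < ((⟨x, -y⟩ : ℂ) * P).re) :
    0 < (exp (-((Real.arctan (y / x) : ℝ) * I)) * P).re := by
  have hs : 0 < Real.sqrt (1 + (y / x) ^ 2) := Real.sqrt_pos.2 (by positivity)
  have e : exp (-((Real.arctan (y / x) : ℝ) * I)) =
      ((1 / (x * Real.sqrt (1 + (y / x) ^ 2)) : ℝ) : ℂ) * ⟨x, -y⟩ := by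
    rw [← neg_mul, ← ofReal_neg, exp_mul_I, ← ofReal_cos, ← ofReal_sin, Real.cos_neg, Real.sin_neg,
      Real.cos_arctan, Real.sin_arctan]
    apply Complex.ext
    · rw [re_ofReal_mul]
      simp only [add_re, ofReal_re, mul_re, I_re, I_im, ofReal_im]
      field_simp
      ring
    · rw [im_ofReal_mul]
      simp only [add_im, ofReal_re, mul_im, I_re, I_im, ofReal_im]
      field_simp
      ring
  rw [e, mul_assoc, re_ofReal_mul]
  exact mul_pos (by positivity) h

theorem stmt_18 (p : ℂ → ℂ) (hp : AnalyticOnNhd ℂ p unitDisk) (hp0 : p 0 = 1)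
    (hpne : ∀ z ∈ unitDisk, p z ≠ 0)
    (b m : ℝ) (hb0 : 0 ≤ b) (hb1 : b ≤ 1) (hm : -1 ≤ m) (hm1 : m ≤ 1)
    (hne : (b : ℂ) + Complex.exp ((m * Real.pi : ℝ) * Complex.I) ≠ 0)
    (lam γ : ℝ) (hlam0 : 0 < lam) (hlam1 : lam ≤ 1) (hγ0 : 0 < γ) (hγ1 : γ ≤ 1)
    (hsub : Subord
      (fun z => (1 - (lam : ℂ)) * p z + (lam : ℂ) * z * deriv p z)
      (fun z => ((1 + Complex.exp ((m * Real.pi : ℝ) * Complex.I) * z) /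
          (1 - (b : ℂ) * z)) ^ (γ : ℂ) *
        (1 - (lam : ℂ) + (lam : ℂ) * (γ : ℂ) *
          ((b : ℂ) + Complex.exp ((m * Real.pi : ℝ) * Complex.I)) * z /
          ((1 + Complex.exp ((m * Real.pi : ℝ) * Complex.I) * z) * (1 - (b : ℂ) * z))))) :
    ∀ z ∈ unitDisk,
      0 < (Complex.exp (-((Real.arctan (b * Real.sin (m * Real.pi) /
          (b * Real.cos (m * Real.pi) + 1)) : ℝ) * Complex.I)) *
        (p z) ^ ((1 / γ : ℝ) : ℂ)).re := by
  obtain ⟨ω, hωa, hω0, hωm, hωeq⟩ := hsub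
  set c : ℂ := Complex.exp ((m * Real.pi : ℝ) * Complex.I) with hcdef
  have hc : ‖c‖ = 1 := norm_exp_ofReal_mul_I _
  obtain ⟨l, hl0, hl, hlp⟩ := exists_exp_eq_of_ne_zero (p := p) hp.differentiableOn hp0 hpne
  have hω : ∀ z : ℂ, ‖z‖ < 1 → ‖ω z‖ ≤ ‖z‖ := fun z hz =>
    norm_le_norm_of_mapsTo_ball (R := 1) hωa.differentiableOn
      (fun u hu => Metric.ball_subset_closedBall (hωm u hu)) hω0 hz
  have heq : ∀ z ∈ Metric.ball (0 : ℂ) 1, (1 - lam : ℂ) * p z + lam * z * deriv p z =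
      (1 - lam) * powMoebius γ b c (ω z) + lam * radialPowMoebius γ b c (ω z) := by
    intro z hz
    refine (hωeq z hz).trans ?_
    rw [radialPowMoebius, powMoebius, moebius]
    ring
  have hlt : ∀ z : ℂ, ‖z‖ < 1 → _ := fun z hz =>
    norm_exp_sub_one_lt hγ0 hγ1 hb0 hb1 hc hne hlam0 hlam1 hl0 hl hlp hω heq hz
  intro z hz
  have hz1 : ‖z‖ < 1 := mem_ball_zero_iff.1 hz
  have hη := one_add_mul_conj_re_pos hb0 hb1 hc hne
  have hseg : ∀ t ∈ Set.Icc (0 : ℝ) 1, ‖(t : ℂ) * z‖ < 1 := by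
    intro t ht
    rw [norm_mul, norm_real, Real.norm_of_nonneg ht.1]
    exact (mul_le_of_le_one_left (norm_nonneg _) ht.2).trans_lt hz1
  have hlog : log (exp (l z / γ)) = l z / γ := log_exp_eq_of_segment (g := fun u => l u / γ)
    (fun t ht => ((hl _ (mem_ball_zero_iff.2 (hseg t ht))).div_const (γ : ℂ)).differentiableAt)
    (by simp [hl0])
    (fun t ht => mem_slitPlane_of_re_mul_pos hη
      (re_mul_pos_of_norm_lt hb0 hb1 hc (hlt _ (hseg t ht))))
  have hγ : (γ : ℂ) ≠ 0 := ofReal_ne_zero.2 hγ0.ne'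
  have him : (l z).im = γ * arg (exp (l z / γ)) := by
    rw [← log_im, hlog, ← im_ofReal_mul, mul_div_cancel₀ _ hγ]
  have harg1 := neg_pi_lt_arg (exp (l z / γ))
  have harg2 := arg_le_pi (exp (l z / γ))
  have hroot : p z ^ ((1 / γ : ℝ) : ℂ) = exp (l z / γ) := by
    rw [cpow_def_of_ne_zero (hpne z hz), ← hlp z hz, log_exp (by rw [him]; nlinarith)
      (by rw [him]; nlinarith [Real.pi_pos])]
    push_cast
    rw [mul_one_div]
  have hcη : 1 + b * (starRingEnd ℂ) c =
      ⟨b * Real.cos (m * Real.pi) + 1, -(b * Real.sin (m * Real.pi))⟩ := by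
    apply Complex.ext
    · rw [add_re, re_ofReal_mul, conj_re, hcdef, exp_ofReal_mul_I_re, one_re, add_comm]
    · rw [add_im, im_ofReal_mul, conj_im, hcdef, exp_ofReal_mul_I_im, one_im]
      ring
  have hP := re_mul_pos_of_norm_lt hb0 hb1 hc (hlt z hz1)
  rw [hcη] at hη hP
  rw [hroot]
  exact re_exp_neg_arctan_mul_pos hη hP
end

section
/- Let p ∈ ℋ₁ and 0 ≤ b ≤ 1. If p(z) + z p'(z) ≺ (1 + 2z − b z²)/(1 − b z)², then p(z) ≺ (1 + z)/(1 − b z). -/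
open Complex

open Metric Set ComplexConjugate

/-- **Jack's lemma**: at a boundary point where `‖w‖` attains its maximum `1`, the logarithmic
derivative `z w' / w` is real and at least `1`. -/
theorem jack_lemma {w : ℂ → ℂ} {a : ℂ} (ha : a ≠ 0) (hd : DifferentiableOn ℂ w (ball 0 ‖a‖))
    (hda : DifferentiableAt ℂ w a) (h0 : w 0 = 0) (hle : ∀ z, ‖z‖ ≤ ‖a‖ → ‖w z‖ ≤ 1)
    (h1 : ‖w a‖ = 1) : ∃ m : ℝ, 1 ≤ m ∧ a * deriv w a = m * w a := by
  have hcc : conj (w a) * w a = 1 := by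
    rw [← normSq_eq_conj_mul_self, normSq_eq_norm_sq, h1]; simp
  have hcn : ‖conj (w a)‖ = 1 := by rw [RCLike.norm_conj, h1]
  have ha' : 0 < ‖a‖ := norm_pos_iff.2 ha
  have hre (u : ℂ) : (conj (w a) * u).re ≤ ‖u‖ :=
    (re_le_norm _).trans_eq (by rw [norm_mul, hcn, one_mul])
  set D := conj (w a) * (a * deriv w a) with hD
  have hDim : D.im = 0 := by
    have hder : HasDerivAt (fun x : ℂ => conj (w a) * w (a * exp (x * I))) (D * I) ((0 : ℝ) : ℂ) := by
      have hin : HasDerivAt (fun x : ℂ => a * exp (x * I)) (a * I) ((0 : ℝ) : ℂ) := by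
        simpa using (((hasDerivAt_id ((0 : ℝ) : ℂ)).mul_const I).cexp).const_mul a
      have := (hda.hasDerivAt.comp_of_eq ((0 : ℝ) : ℂ) hin (by simp)).const_mul (conj (w a))
      exact this.congr_deriv (by rw [hD]; ring)
    have hmax : IsLocalMax (fun x : ℝ => (conj (w a) * w (a * exp (x * I))).re) 0 := by
      refine Filter.Eventually.of_forall fun x => ?_
      simp only [ofReal_zero, zero_mul, exp_zero, mul_one, hcc, one_re]
      exact (hre _).trans (hle _ (by simp [norm_exp_ofReal_mul_I]))
    simpa using hmax.hasDerivAt_eq_zero hder.real_of_complex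
  have hDre : 1 ≤ D.re := by
    have hder : HasDerivAt (fun x : ℂ => conj (w a) * w (a * x) - x) (D - 1) ((1 : ℝ) : ℂ) := by
      have hin : HasDerivAt (fun x : ℂ => a * x) a ((1 : ℝ) : ℂ) := by
        simpa using (hasDerivAt_id ((1 : ℝ) : ℂ)).const_mul a
      have := ((hda.hasDerivAt.comp_of_eq ((1 : ℝ) : ℂ) hin (by simp)).const_mul (conj (w a))).sub
        (hasDerivAt_id ((1 : ℝ) : ℂ))
      exact this.congr_deriv (by rw [hD]; ring)
    have hmax : IsLocalMaxOn (fun x : ℝ => (conj (w a) * w (a * x) - x).re) (Icc 0 1) 1 := by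
      filter_upwards [self_mem_nhdsWithin] with x hx
      simp only [ofReal_one, mul_one, hcc, sub_self, zero_re, sub_re, ofReal_re]
      rw [sub_nonpos]
      refine (hre _).trans ?_
      rcases hx.2.eq_or_lt with rfl | hx1
      · simp [h1]
      · have hax : ‖a * x‖ = ‖a‖ * x := by simp [abs_of_nonneg hx.1]
        have := dist_le_div_mul_dist_of_mapsTo_ball (R₂ := 1) hd (z := a * x)
          (fun z hz => by simpa [h0] using hle z (mem_ball_zero_iff.1 hz).le)
          (by rw [mem_ball_zero_iff, hax]; nlinarith)
        rw [h0, dist_zero_right, dist_zero_right, hax] at this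
        exact this.trans_eq (by field_simp)
    have hcone : (-1 : ℝ) ∈ posTangentConeAt (Icc (0 : ℝ) 1) 1 := by
      refine mem_posTangentConeAt_of_segment_subset ?_
      rw [segment_symm, segment_eq_Icc (by norm_num)]
      norm_num
    have := hmax.hasFDerivWithinAt_nonpos
      hder.real_of_complex.hasFDerivAt.hasFDerivWithinAt hcone
    simp at this
    linarith
  refine ⟨D.re, hDre, ?_⟩
  have hDr : (D.re : ℂ) = D := Complex.ext (by simp) (by simp [hDim])
  rw [hDr, hD]
  linear_combination (-(a * deriv w a)) * hcc

theorem norm_one_add_mul_le_norm_one_sub {c : ℂ} {s : ℝ} (hs : 0 ≤ s)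
    (h₁ : ‖2 + s * c‖ ≤ ‖c‖) : ‖1 + s * c‖ ≤ ‖1 - c‖ := by
  have hsq (u : ℂ) : ‖u‖ ^ 2 = u.re ^ 2 + u.im ^ 2 := by
    rw [← normSq_eq_norm_sq, normSq_apply]; ring
  have e₁ := pow_le_pow_left₀ (norm_nonneg _) h₁ 2
  refine le_of_sq_le_sq ?_ (norm_nonneg _)
  rw [hsq, hsq] at e₁ ⊢
  simp only [add_re, add_im, mul_re, mul_im, sub_re, sub_im, ofReal_re, ofReal_im, one_re, one_im,
    re_ofNat, im_ofNat, zero_mul, sub_zero, add_zero, zero_add, zero_sub] at e₁ ⊢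
  suffices h : 2 * c.re ≤ (1 - s) * (c.re ^ 2 + c.im ^ 2) by nlinarith
  by_contra! hlt
  have e₂ : 4 + 4 * s * c.re ≤ (1 - s ^ 2) * (c.re ^ 2 + c.im ^ 2) := by linarith
  have h₂ : 2 < (1 - s) * c.re := by nlinarith
  have hN : c.re ^ 2 ≤ c.re ^ 2 + c.im ^ 2 := le_add_of_nonneg_right (sq_nonneg _)
  generalize c.re ^ 2 + c.im ^ 2 = N at *
  rcases lt_or_ge s 1 with hs1 | hs1
  · have hpos : 0 < c.re := pos_of_mul_pos_right (by linarith) (sub_nonneg.2 hs1.le)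
    nlinarith [mul_le_mul_of_nonneg_left hN (sub_nonneg.2 hs1.le)]
  · have hneg : c.re < 0 := by nlinarith
    have hprod : 0 < ((s + 1) * c.re + 2) * ((s - 1) * c.re + 2) :=
      mul_pos_of_neg_of_neg (by nlinarith) (by linarith)
    nlinarith [mul_le_mul_of_nonneg_left hN (by nlinarith : 0 ≤ s ^ 2 - 1)]

/-- For `‖X‖ < ‖Y‖ ≤ 1` and `t ≥ 0` one never has
`(1 - X)⁻² - (1 - Y)⁻² = t * Y * (1 - Y)⁻²`. -/
theorem not_mul_eq_of_norm_lt {X Y : ℂ} {t : ℝ} (hXY : ‖X‖ < ‖Y‖) (hY : ‖Y‖ ≤ 1) (hY1 : Y ≠ 1)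
    (ht : 0 ≤ t) : (X - Y) * (2 - X - Y) ≠ t * Y * (1 - X) ^ 2 := by
  intro h
  have hX1 : 1 - X ≠ 0 := by
    intro h0
    rw [← sub_eq_zero.1 h0, norm_one] at hXY
    exact hXY.not_ge hY
  have hY0 : Y ≠ 0 := norm_pos_iff.1 ((norm_nonneg X).trans_lt hXY)
  have hne : Y - X ≠ 0 := sub_ne_zero.2 fun h0 => by simp [h0] at hXY
  set c := (Y - X) / (Y * (1 - X)) with hc
  set g := (1 - Y) / (1 - X) with hg
  have hg0 : g ≠ 0 := div_ne_zero (sub_ne_zero.2 hY1.symm) hX1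
  have hc0 : c ≠ 0 := div_ne_zero hne (mul_ne_zero hY0 hX1)
  have hprod : (1 + g) * c = -t := by
    rw [hc, hg]; field_simp; linear_combination -h
  have hn : (normSq c : ℂ) ≠ 0 := by exact_mod_cast (normSq_pos.2 hc0).ne'
  set s := t / normSq c with hs
  have hs0 : 0 ≤ s := div_nonneg ht (normSq_nonneg c)
  have hgs : 1 + g = -(s * conj c) := by
    rw [hs]; push_cast
    rw [normSq_eq_conj_mul_self] at hn ⊢
    have : conj c ≠ 0 := left_ne_zero_of_mul hn
    field_simp
    linear_combination hprod
  have hk : 1 - c = g * (X / Y) := by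
    rw [hc, hg]; field_simp; ring
  have hcY : 1 - g = c * Y := by
    rw [hc, hg]; field_simp; ring
  have e₁ : ‖2 + s * c‖ = ‖1 - g‖ := by
    rw [← RCLike.norm_conj (2 + s * c)]
    congr 1
    simp only [map_add, map_mul, conj_ofReal, map_ofNat]
    linear_combination hgs
  have e₂ : ‖1 + s * c‖ = ‖g‖ := by
    rw [← RCLike.norm_conj (1 + s * c), ← norm_neg g]
    congr 1
    simp only [map_add, map_mul, conj_ofReal, map_one]
    linear_combination hgs
  have h₁ := norm_one_add_mul_le_norm_one_sub hs0 (c := c) (by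
    rw [e₁, hcY, norm_mul]; exact mul_le_of_le_one_right (norm_nonneg c) hY)
  rw [e₂, hk, norm_mul] at h₁
  have : ‖X / Y‖ < 1 := by
    rw [norm_div]
    exact (div_lt_one (norm_pos_iff.2 hY0)).2 hXY
  nlinarith [norm_pos_iff.2 hg0]

/-- The boundary condition: with `q z = (1 + z) / (1 - b z)` and `m ≥ 1`, the values
`q ζ + m ζ q' ζ` at points `ζ` of the unit circle lie outside the image of the open disk
under `q z + z q' z`. -/
theorem boundary_value_ne {b m : ℝ} (hb0 : 0 ≤ b) (hb1 : b ≤ 1) (hm : 1 ≤ m) {x ζ : ℂ}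
    (hx : ‖x‖ < 1) (hζ : ‖ζ‖ = 1) (hbζ : 1 - b * ζ ≠ 0) :
    (1 + ζ) / (1 - b * ζ) + m * ((1 + b) * ζ / (1 - b * ζ) ^ 2) ≠
      (1 + 2 * x - b * x ^ 2) / (1 - b * x) ^ 2 := by
  intro h
  have hbx : 1 - b * x ≠ 0 := by
    intro h0
    have : ‖(b : ℂ) * x‖ = 1 := by rw [← sub_eq_zero.1 h0, norm_one]
    rw [norm_mul, norm_real, Real.norm_of_nonneg hb0] at this
    nlinarith [norm_nonneg x]
  have hb : (1 + b : ℂ) ≠ 0 := by exact_mod_cast (by linarith : (1 + b : ℝ) ≠ 0)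
  have key : (x - ζ) * (2 - b * x - b * ζ) = (m - 1 : ℝ) * ζ * (1 - b * x) ^ 2 := by
    refine mul_left_cancel₀ hb ?_
    push_cast
    have h' : ((1 + ζ) * (1 - b * ζ) + m * ((1 + b) * ζ)) / (1 - b * ζ) ^ 2 =
        (1 + 2 * x - b * x ^ 2) / (1 - b * x) ^ 2 := by
      rw [← h]; field_simp
    rw [div_eq_div_iff (pow_ne_zero 2 hbζ) (pow_ne_zero 2 hbx)] at h'
    linear_combination -h'
  rcases hb0.eq_or_lt with rfl | hbpos
  · have h2 : 2 * x = ((m + 1 : ℝ) : ℂ) * ζ := by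
      push_cast at key ⊢
      linear_combination key
    have := congrArg norm h2
    rw [norm_mul, norm_mul, hζ, norm_real, Real.norm_of_nonneg (by linarith)] at this
    norm_num at this
    linarith
  · have hnorm (u : ℂ) : ‖(b : ℂ) * u‖ = b * ‖u‖ := by
      rw [norm_mul, norm_real, Real.norm_of_nonneg hb0]
    refine not_mul_eq_of_norm_lt (X := b * x) (Y := b * ζ) (t := m - 1) ?_ ?_ ?_ (by linarith)
      (by linear_combination (b : ℂ) * key)
    · rw [hnorm, hnorm, hζ]; gcongr
    · rw [hnorm, hζ]; linarith
    · exact fun h0 => hbζ (by rw [h0, sub_self])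

theorem stmt_19 (p : ℂ → ℂ) (hp : AnalyticOnNhd ℂ p unitDisk) (hp0 : p 0 = 1)
    (b : ℝ) (hb0 : 0 ≤ b) (hb1 : b ≤ 1)
    (hsub : Subord (fun z => p z + z * deriv p z)
      (fun z => (1 + 2 * z - (b : ℂ) * z ^ 2) / (1 - (b : ℂ) * z) ^ 2)) :
    Subord p (fun z => (1 + z) / (1 - (b : ℂ) * z)) := by
  obtain ⟨ω, -, -, hω, hpω⟩ := hsub
  have hb : (1 + b : ℂ) ≠ 0 := by exact_mod_cast (by linarith : (1 + b : ℝ) ≠ 0)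
  have hmem {z : ℂ} : z ∈ unitDisk ↔ ‖z‖ < 1 := mem_ball_zero_iff
  set w : ℂ → ℂ := fun z => (p z - 1) / (1 + b * p z) with hw
  have hden {z : ℂ} (hz : ‖p z - 1‖ ≤ ‖1 + b * p z‖) : 1 + b * p z ≠ 0 := by
    intro h0
    rw [h0, norm_zero, norm_le_zero_iff, sub_eq_zero] at hz
    rw [hz, mul_one] at h0
    exact hb h0
  have hanal {z : ℂ} (hz : z ∈ unitDisk) (h : ‖p z - 1‖ ≤ ‖1 + b * p z‖) : AnalyticAt ℂ w z :=
    ((hp z hz).sub analyticAt_const).div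
      (analyticAt_const.add (analyticAt_const.mul (hp z hz))) (hden h)
  have hw0 : w 0 = 0 := by simp [hw, hp0]
  have hid {z : ℂ} (h : ‖p z - 1‖ ≤ ‖1 + b * p z‖) : 1 - b * w z = (1 + b) / (1 + b * p z) := by
    have := hden h
    simp only [hw]; field_simp; ring
  have hpw {z : ℂ} (h : ‖p z - 1‖ ≤ ‖1 + b * p z‖) : p z = (1 + w z) / (1 - b * w z) := by
    have := hden h
    have hwz : w z * (1 + b * p z) = p z - 1 := div_mul_cancel₀ _ this
    rw [hid h, eq_div_iff (div_ne_zero hb this), ← mul_div_assoc, div_eq_iff this]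
    linear_combination -hwz
  have hlt : ∀ z ∈ unitDisk, ‖p z - 1‖ < ‖1 + b * p z‖ := by
    by_contra! hcon
    obtain ⟨z₁, hz₁, hF₁⟩ := hcon
    rw [hmem] at hz₁
    set F : ℂ → ℝ := fun z => ‖1 + b * p z‖ - ‖p z - 1‖ with hF
    have hFc : ContinuousOn F (closedBall 0 ‖z₁‖) := by
      have hpc : ContinuousOn p (closedBall 0 ‖z₁‖) := fun z hz =>
        (hp z (hmem.2 ((mem_closedBall_zero_iff.1 hz).trans_lt hz₁))).continuousAt.continuousWithinAt
      exact ((continuousOn_const.add (continuousOn_const.mul hpc)).norm).sub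
        (hpc.sub continuousOn_const).norm
    have hK : IsCompact (closedBall (0 : ℂ) ‖z₁‖ ∩ F ⁻¹' Iic 0) :=
      (isCompact_closedBall 0 ‖z₁‖).of_isClosed_subset
        (hFc.preimage_isClosed_of_isClosed isClosed_closedBall isClosed_Iic) inter_subset_left
    obtain ⟨a, ⟨haB, haF⟩, hmin⟩ := hK.exists_isMinOn
      ⟨z₁, by simp, by simpa [hF] using hF₁⟩ continuous_norm.continuousOn
    rw [mem_closedBall_zero_iff] at haB
    have ha1 : ‖a‖ < 1 := haB.trans_lt hz₁
    have ha0 : a ≠ 0 := by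
      rintro rfl
      simp only [hF, mem_preimage, hp0, mem_Iic, mul_one, sub_self, norm_zero, sub_zero,
        norm_le_zero_iff] at haF
      exact hb haF
    have hpos {z : ℂ} (hz : ‖z‖ < ‖a‖) : 0 < F z := by
      by_contra! hneg
      exact hz.not_ge (hmin ⟨mem_closedBall_zero_iff.2 (hz.le.trans haB), hneg⟩)
    have hcl {z : ℂ} (hz : ‖z‖ ≤ ‖a‖) : ‖p z - 1‖ ≤ ‖1 + b * p z‖ := by
      rw [← sub_nonneg]
      have hz' : z ∈ closure (ball (0 : ℂ) ‖a‖) := by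
        rw [closure_ball _ (norm_ne_zero_iff.2 ha0)]
        simpa using hz
      have hsub' : closure (ball (0 : ℂ) ‖a‖) ⊆ closedBall 0 ‖z₁‖ :=
        closure_ball_subset_closedBall.trans (closedBall_subset_closedBall haB)
      exact le_on_closure (f := fun _ => (0 : ℝ)) (fun y hy => (hpos (mem_ball_zero_iff.1 hy)).le)
        continuousOn_const (hFc.mono hsub') hz'
    have haEq : ‖p a - 1‖ = ‖1 + b * p a‖ := (hcl le_rfl).antisymm (sub_nonpos.1 haF)
    have hwn : ‖w a‖ = 1 := by
      simp only [hw, norm_div, haEq]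
      exact div_self (norm_ne_zero_iff.2 (hden (hcl le_rfl)))
    have hda := (hanal (hmem.2 ha1) (hcl le_rfl)).differentiableAt
    obtain ⟨m, hm, hmw⟩ := jack_lemma (w := w) ha0
      (fun z hz => by
        have hz := (mem_ball_zero_iff.1 hz).le
        exact (hanal (hmem.2 (hz.trans_lt ha1)) (hcl hz)).differentiableAt.differentiableWithinAt)
      hda hw0
      (fun z hz => by
        simp only [hw, norm_div]
        exact div_le_one_of_le₀ (hcl hz) (norm_nonneg _))
      hwn
    have hbw : 1 - b * w a ≠ 0 := by
      rw [hid (hcl le_rfl)]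
      exact div_ne_zero hb (hden (hcl le_rfl))
    have hpd := (hp a (hmem.2 ha1)).differentiableAt.hasDerivAt
    have hwd : HasDerivAt w ((1 + b) * deriv p a / (1 + b * p a) ^ 2) a := by
      exact ((hpd.sub_const 1).div ((hpd.const_mul (b : ℂ)).const_add 1)
        (hden (hcl le_rfl))).congr_deriv (by ring)
    refine boundary_value_ne hb0 hb1 hm (hmem.1 (hω a (hmem.2 ha1))) hwn hbw ?_
    refine Eq.trans ?_ (hpω a (hmem.2 ha1))
    rw [← hpw (hcl le_rfl)]
    congr 1
    rw [hwd.deriv] at hmw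
    have := hden (hcl le_rfl)
    rw [hid (hcl le_rfl)]
    field_simp at hmw ⊢
    linear_combination -hmw
  refine ⟨w, fun z hz => hanal hz (hlt z hz).le, hw0, fun z hz => ?_, fun z hz => hpw (hlt z hz).le⟩
  rw [hmem]
  simp only [hw, norm_div]
  exact (div_lt_one ((norm_nonneg _).trans_lt (hlt z hz))).2 (hlt z hz)
end
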